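/- arXiv:2603.09829 — 12 statements merged into one kernel-verified Lean document; each statement's English description precedes it below -/
import Mathlib

section
/- For every real α > 0 and every integer j ≥ 1, the equation x·sin x = α·cos x has exactly one solution x in the open interval ((j−1)π, (j−1/2)π). Moreover, every real x > 0 satisfying x·sin x = α·cos x lies in ((j−1)π, (j−1/2)π) for some integer j ≥ 1; in particular no positive solution is an integer multiple of π and no positive solution lies in any interval [(j−1/2)π, jπ]. -/
open Real Set

/-- The equation `x * sin x = α * cos x` at `t + n * π`, after cancelling the sign `(-1) ^ n`. -/
lemma add_nat_mul_pi_mul_sin_eq_iff (α t : ℝ) (n : ℕ) :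
    (t + n * π) * Real.sin (t + n * π) = α * Real.cos (t + n * π) ↔
      (t + n * π) * Real.sin t = α * Real.cos t := by
  have h : ((-1 : ℝ)) ^ n ≠ 0 := by positivity
  rw [Real.sin_add_nat_mul_pi, Real.cos_add_nat_mul_pi, mul_left_comm, mul_left_comm α,
    mul_right_inj' h]

lemma strictMonoOn_add_mul_sin_sub_mul_cos {α c : ℝ} (hα : 0 < α) (hc : 0 ≤ c) :
    StrictMonoOn (fun t => (t + c) * Real.sin t - α * Real.cos t) (Set.Icc 0 (π / 2)) := by
  intro a ha b hb hab
  have hsin : Real.sin a ≤ Real.sin b :=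
    Real.sin_le_sin_of_le_of_le_pi_div_two (by linarith [ha.1, Real.pi_pos]) hb.2 hab.le
  have hcos : Real.cos b < Real.cos a :=
    Real.cos_lt_cos_of_nonneg_of_le_pi_div_two ha.1 hb.2 hab
  have hsin0 : 0 ≤ Real.sin a :=
    Real.sin_nonneg_of_nonneg_of_le_pi ha.1 (by linarith [ha.2, Real.pi_pos])
  have h₁ : (a + c) * Real.sin a ≤ (b + c) * Real.sin b :=
    mul_le_mul (by linarith) hsin hsin0 (by linarith [hb.1])
  have h₂ : α * Real.cos b < α * Real.cos a := mul_lt_mul_of_pos_left hcos hα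
  change (a + c) * Real.sin a - α * Real.cos a < (b + c) * Real.sin b - α * Real.cos b
  linarith

lemma existsUnique_add_mul_sin_eq_mul_cos {α c : ℝ} (hα : 0 < α) (hc : 0 ≤ c) :
    ∃! t : ℝ, t ∈ Set.Ioo 0 (π / 2) ∧ (t + c) * Real.sin t = α * Real.cos t := by
  have hmono := strictMonoOn_add_mul_sin_sub_mul_cos hα hc
  have hpi := Real.pi_pos
  have hcont : ContinuousOn (fun t => (t + c) * Real.sin t - α * Real.cos t)
      (Set.Icc 0 (π / 2)) := by fun_prop
  obtain ⟨t, ht, hft⟩ := intermediate_value_Ioo (by positivity) hcont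
    (show (0 : ℝ) ∈ Set.Ioo _ _ from ⟨by simpa using hα, by simp; positivity⟩)
  refine ⟨t, ⟨ht, sub_eq_zero.mp hft⟩, fun s hs => ?_⟩
  exact hmono.injOn (Set.Ioo_subset_Icc_self hs.1) (Set.Ioo_subset_Icc_self ht)
    ((sub_eq_zero.mpr hs.2).trans hft.symm)

lemma mem_Ioo_of_add_mul_sin_eq_mul_cos {α c t : ℝ} (hα : 0 < α) (hc : 0 ≤ c)
    (ht : t ∈ Set.Ico 0 π) (h : (t + c) * Real.sin t = α * Real.cos t) :
    t ∈ Set.Ioo 0 (π / 2) := by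
  have ht0 : 0 < t := by
    refine ht.1.lt_of_ne ?_
    rintro rfl
    simp [hα.ne] at h
  refine ⟨ht0, ?_⟩
  by_contra! hle
  have hsin : 0 < Real.sin t := Real.sin_pos_of_pos_of_lt_pi ht0 ht.2
  have hcos : Real.cos t ≤ 0 :=
    Real.cos_nonpos_of_pi_div_two_le_of_le hle (by linarith [ht.2, Real.pi_pos])
  have h₁ : 0 < (t + c) * Real.sin t := by positivity
  linarith [mul_nonpos_of_nonneg_of_nonpos hα.le hcos]

lemma exists_nat_mem_Ioo_of_mul_sin_eq_mul_cos {α x : ℝ} (hα : 0 < α) (hx : 0 < x)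
    (h : x * Real.sin x = α * Real.cos x) :
    ∃ n : ℕ, x ∈ Set.Ioo (n * π) ((n + 1 / 2) * π) := by
  have hpi := Real.pi_pos
  have h₁ : ⌊x / π⌋₊ * π ≤ x := (le_div_iff₀ hpi).mp (Nat.floor_le (by positivity))
  have h₂ : x < (⌊x / π⌋₊ + 1) * π := (div_lt_iff₀ hpi).mp (Nat.lt_floor_add_one _)
  generalize ⌊x / π⌋₊ = n at h₁ h₂
  obtain ⟨t, rfl⟩ : ∃ t, x = t + n * π := ⟨x - n * π, by ring⟩
  rw [add_nat_mul_pi_mul_sin_eq_iff] at h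
  obtain ⟨h₃, h₄⟩ := mem_Ioo_of_add_mul_sin_eq_mul_cos hα (by positivity)
    ⟨by linarith, by linarith⟩ h
  exact ⟨n, by linarith, by linarith⟩

/-- For every real `α > 0` and every integer `j ≥ 1`, the equation `x·sin x = α·cos x`
has exactly one solution in `((j−1)π, (j−1/2)π)`; moreover every positive solution lies
in such an interval, is not an integer multiple of `π`, and lies in no interval
`[(j−1/2)π, jπ]`. -/
theorem stmt_0 (α : ℝ) (hα : 0 < α) :
    (∀ j : ℕ, 1 ≤ j →
      ∃! x : ℝ, x ∈ Set.Ioo (((j : ℝ) - 1) * π) (((j : ℝ) - 1/2) * π) ∧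
        x * Real.sin x = α * Real.cos x) ∧
    (∀ x : ℝ, 0 < x → x * Real.sin x = α * Real.cos x →
      ∃ j : ℕ, 1 ≤ j ∧ x ∈ Set.Ioo (((j : ℝ) - 1) * π) (((j : ℝ) - 1/2) * π)) ∧
    (∀ x : ℝ, 0 < x → x * Real.sin x = α * Real.cos x →
      (∀ n : ℤ, x ≠ (n : ℝ) * π) ∧
      ∀ j : ℕ, 1 ≤ j → x ∉ Set.Icc (((j : ℝ) - 1/2) * π) ((j : ℝ) * π)) := by
  have hpi := Real.pi_pos
  refine ⟨fun j hj => ?_, fun x hx h => ?_, fun x hx h => ?_⟩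
  · obtain ⟨n, rfl⟩ := Nat.exists_eq_add_of_le' hj
    obtain ⟨t, ⟨ht, hteq⟩, huniq⟩ :=
      existsUnique_add_mul_sin_eq_mul_cos hα (c := n * π) (by positivity)
    push_cast
    refine ⟨t + n * π, ⟨⟨by linarith [ht.1], by linarith [ht.2]⟩,
      (add_nat_mul_pi_mul_sin_eq_iff α t n).mpr hteq⟩, ?_⟩
    rintro x ⟨⟨hx₁, hx₂⟩, hx⟩
    obtain ⟨s, rfl⟩ : ∃ s, x = s + n * π := ⟨x - n * π, by ring⟩
    rw [huniq s ⟨⟨by linarith, by linarith⟩, (add_nat_mul_pi_mul_sin_eq_iff α s n).mp hx⟩]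
  · obtain ⟨n, h₁, h₂⟩ := exists_nat_mem_Ioo_of_mul_sin_eq_mul_cos hα hx h
    refine ⟨n + 1, by omega, ?_, ?_⟩ <;> push_cast <;> linarith
  · obtain ⟨n, h₁, h₂⟩ := exists_nat_mem_Ioo_of_mul_sin_eq_mul_cos hα hx h
    refine ⟨?_, ?_⟩
    · rintro m rfl
      have h₃ : (n : ℝ) < m := lt_of_mul_lt_mul_right h₁ hpi.le
      have h₄ : (m : ℝ) < n + 1 := by linarith [lt_of_mul_lt_mul_right h₂ hpi.le]
      norm_cast at h₃ h₄
      omega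
    · rintro j - ⟨hj₁, hj₂⟩
      have h₃ : (n : ℝ) < j := lt_of_mul_lt_mul_right (h₁.trans_le hj₂) hpi.le
      have h₄ : (j : ℝ) < n + 1 := by
        linarith [lt_of_mul_lt_mul_right (hj₁.trans_lt h₂) hpi.le]
      norm_cast at h₃ h₄
      omega
end

section
/- For α > 0 and an integer j ≥ 2, set x_{j,α} := r(j,α) − (j−1)π ∈ (0, π/2) and λ_{j,0} := ((j−1)π)². Then there exists a function η : (0,1) → [0,∞) with η(α)/α² → 0 as α → 0⁺, such that for every integer j ≥ 2 and every α ∈ (0,1): | x_{j,α} − α/√λ_{j,0} + α²/λ_{j,0}^{3/2} | ≤ η(α)/λ_{j,0}^{3/2}. That is, x_{j,α} = α/√λ_{j,0} − α²/λ_{j,0}^{3/2} + o(α²)/λ_{j,0}^{3/2} as α → 0⁺, with an error uniform in j ≥ 2. -/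
theorem abs_sub_add_le_of_add_mul_sin_eq {L x α : ℝ} (hL : 1 ≤ L) (hx : 0 < x)
    (hx' : x < Real.pi / 2) (hα : 0 < α) (hα' : α < 1)
    (h : (L + x) * Real.sin x = α * Real.cos x) :
    |x - α / L + α ^ 2 / L ^ 3| ≤ 4 * α ^ 3 / L ^ 3 := by
  have hc : 0 < Real.cos x := Real.cos_pos_of_mem_Ioo ⟨by linarith, hx'⟩
  obtain ⟨u, hu⟩ : ∃ u, u = Real.tan x := ⟨_, rfl⟩
  have hxu : x < u := hu ▸ Real.lt_tan hx hx'
  have hsin : u * Real.cos x = Real.sin x := by rw [hu, Real.tan_mul_cos hc.ne']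
  have hmul : (L + x) * u = α := by
    apply mul_right_cancel₀ hc.ne'
    rw [mul_assoc, hsin, h]
  have hL0 : 0 < L := by linarith
  obtain ⟨t, ht⟩ : ∃ t, t = 1 / L := ⟨_, rfl⟩
  have ht0 : 0 < t := by rw [ht]; positivity
  have ht1 : t ≤ 1 := by rw [ht, div_le_one hL0]; exact hL
  obtain ⟨a, ha⟩ : ∃ a, a = α / L := ⟨_, rfl⟩
  have ha0 : 0 < a := by rw [ha]; positivity
  have ha1 : a ≤ 1 := by rw [ha, div_le_one hL0]; linarith
  have hau : a = u + x * u * t := by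
    rw [ha, ht, ← hmul]; field_simp
  have hu0 : 0 < u := hx.trans hxu
  have hua : u ≤ a := by rw [hau]; nlinarith [mul_pos (mul_pos hx hu0) ht0]
  have hxa : x ≤ a := by linarith
  have hx2 : x ^ 2 ≤ a ^ 2 := by gcongr
  have hgap : u - x ≤ a ^ 3 / 2 := by
    have h1 : u * (1 - x ^ 2 / 2) ≤ u * Real.cos x :=
      mul_le_mul_of_nonneg_left (Real.one_sub_sq_div_two_le_cos) hu0.le
    have h2 : u * x ^ 2 ≤ a * a ^ 2 := by gcongr
    nlinarith [Real.sin_lt hx]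
  have hxua : x * u ≤ a ^ 2 := by
    have : x * u ≤ a * a := by gcongr
    nlinarith
  have hax : a - x ≤ 3 / 2 * a ^ 2 := by
    have h1 : x * u * t ≤ a ^ 2 * 1 := by gcongr
    have h2 : a ^ 2 * a ≤ a ^ 2 * 1 := by gcongr
    nlinarith
  have hupper : a ^ 2 - x * u ≤ 3 * a ^ 3 := by
    have h1 : x * x ≤ x * u := by gcongr
    have h2 : (a - x) * (a + x) ≤ (3 / 2 * a ^ 2) * (a + a) := by gcongr
    nlinarith
  have hcomb : t * (a ^ 2 - x * u) ≤ 1 * (3 * a ^ 3) :=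
    mul_le_mul ht1 hupper (by linarith) zero_le_one
  have hcomb0 : 0 ≤ t * (a ^ 2 - x * u) := mul_nonneg ht0.le (by linarith)
  have ha3 : 0 < a ^ 3 := by positivity
  have e1 : x - α / L + α ^ 2 / L ^ 3 = (x - u) + t * (a ^ 2 - x * u) := by
    have : α ^ 2 / L ^ 3 = t * a ^ 2 := by rw [ha, ht]; field_simp
    rw [this, ← ha]; linear_combination -hau
  have e2 : 4 * α ^ 3 / L ^ 3 = 4 * a ^ 3 := by rw [ha]; field_simp
  rw [e1, e2, abs_le]
  constructor <;> linarith


/-- Uniform asymptotics of the higher Robin eigenvalue square roots: with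
`r j α ∈ ((j−1)π, (j−1/2)π)` the unique solution of `x·sin x = α·cos x`,
`x_{j,α} := r j α − (j−1)π` satisfies
`x_{j,α} = α/√λ_{j,0} − α²/λ_{j,0}^{3/2} + o(α²)/λ_{j,0}^{3/2}` as `α → 0⁺`,
uniformly in `j ≥ 2`, where `λ_{j,0} = ((j−1)π)²`. -/
theorem stmt_3 (r : ℕ → ℝ → ℝ)
    (hr : ∀ j : ℕ, 1 ≤ j → ∀ α : ℝ, 0 < α →
      r j α ∈ Set.Ioo (((j:ℝ) - 1) * Real.pi) (((j:ℝ) - 1/2) * Real.pi) ∧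
      r j α * Real.sin (r j α) = α * Real.cos (r j α)) :
    ∃ η : ℝ → ℝ, (∀ α ∈ Set.Ioo (0:ℝ) 1, 0 ≤ η α) ∧
      Filter.Tendsto (fun α => η α / α ^ 2) (nhdsWithin 0 (Set.Ioi 0)) (nhds 0) ∧
      ∀ j : ℕ, 2 ≤ j → ∀ α ∈ Set.Ioo (0:ℝ) 1,
        |r j α - ((j:ℝ) - 1) * Real.pi
            - α / Real.sqrt ((((j:ℝ) - 1) * Real.pi) ^ 2)
            + α ^ 2 / ((((j:ℝ) - 1) * Real.pi) ^ 2) ^ ((3:ℝ)/2)|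
          ≤ η α / ((((j:ℝ) - 1) * Real.pi) ^ 2) ^ ((3:ℝ)/2) := by
  refine ⟨fun α => 4 * α ^ 3, fun α hα => ?_, ?_, fun j hj α hα => ?_⟩
  · have := hα.1
    positivity
  · have h : Filter.Tendsto (fun α : ℝ => 4 * α) (nhdsWithin 0 (Set.Ioi 0)) (nhds 0) := by
      have : Continuous fun α : ℝ => 4 * α := by fun_prop
      simpa using (this.tendsto 0).mono_left nhdsWithin_le_nhds
    refine h.congr' ?_
    filter_upwards [self_mem_nhdsWithin] with α hα
    have : α ≠ 0 := ne_of_gt hα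
    field_simp
  · obtain ⟨⟨hl, hu⟩, heq⟩ := hr j (by omega) α hα.1
    obtain ⟨n, rfl⟩ : ∃ n, j = n + 1 := ⟨j - 1, by omega⟩
    generalize r (n + 1) α = ρ at *
    have hn : (1 : ℝ) ≤ n := by exact_mod_cast (by omega : 1 ≤ n)
    push_cast at *
    rw [add_sub_cancel_right] at *
    have hL : 1 ≤ (n : ℝ) * Real.pi := by nlinarith [Real.pi_gt_three]
    have hL0 : 0 ≤ (n : ℝ) * Real.pi := by linarith
    have hpow : (((n : ℝ) * Real.pi) ^ 2) ^ ((3 : ℝ) / 2) = ((n : ℝ) * Real.pi) ^ 3 := by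
      rw [← Real.rpow_natCast, ← Real.rpow_mul hL0, ← Real.rpow_natCast]
      norm_num
    rw [hpow, Real.sqrt_sq hL0]
    refine abs_sub_add_le_of_add_mul_sin_eq hL (by linarith) (by linarith) hα.1 hα.2 ?_
    rw [Real.sin_sub_nat_mul_pi, Real.cos_sub_nat_mul_pi]
    linear_combination (-1) ^ n * heq
end

section
/- For α > 0 and an integer j ≥ 2, set P(j,α) := 2·cos(r(j,α)) / (1 + sin²(r(j,α))/α) and λ_{j,0} := ((j−1)π)². Then there exists a function η : (0,1) → [0,∞) with η(α)/α² → 0 as α → 0⁺, such that for every integer j ≥ 2 and every α ∈ (0,1): | (−1)^{j−1}·P(j,α) − 2·( 1 − α/λ_{j,0} − α²/(2λ_{j,0}) + 3α²/λ_{j,0}² ) | ≤ η(α)/λ_{j,0}². That is, (−1)^{j−1}P(j,α) = 2(1 − α/λ_{j,0} − α²/(2λ_{j,0}) + 3α²/λ_{j,0}²) + o(α²)/λ_{j,0}² as α → 0⁺, with an error uniform in j ≥ 2. -/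
/-- Expansion of `S / (1 + (α + α²) y)` with `S = √(1 + α² y)` when `1 / y = 1 / l + 2 α + O(α²)`. -/
theorem abs_quotient_sub_expansion_le {α l y S d : ℝ} (hα : 0 < α) (hα1 : α < 1) (hl1 : l ≤ 1)
    (hy : 0 < y) (hyl : y ≤ l) (hd2 : d ≤ 2 * α) (hd : 2 * α - 3 * α ^ 2 ≤ d)
    (hlyd : l - y = d * (l * y)) (hS0 : 0 < S) (hS : S ^ 2 = 1 + α ^ 2 * y) :
    |S / (1 + (α + α ^ 2) * y) - (1 - α * l - α ^ 2 * l / 2 + 3 * α ^ 2 * l ^ 2)|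
      ≤ 25 * α ^ 3 * l ^ 2 := by
  have hl : 0 < l := hy.trans_le hyl
  have hly : l * y ≤ l ^ 2 := by nlinarith
  have hly0 : 0 < l * y := by positivity
  have hyy : y ^ 2 ≤ l ^ 2 := by gcongr
  have hll : l ^ 2 ≤ 1 := by nlinarith
  have hα3 : 0 < α ^ 3 := by positivity
  have hα43 : α ^ 4 ≤ α ^ 3 := by nlinarith
  have hα23 : α ^ 2 ≤ α := by nlinarith
  have hdiff : l - y ≤ 2 * α * l ^ 2 := by
    rw [hlyd]; gcongr
  have hfine : |y - l + 2 * α * l ^ 2| ≤ 7 * α ^ 2 * l ^ 2 := by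
    have e : y - l + 2 * α * l ^ 2 = (2 * α - d) * (l * y) + 2 * α * (l * (l - y)) := by
      linear_combination -hlyd
    have h1 : (2 * α - d) * (l * y) ≤ 3 * α ^ 2 * l ^ 2 := by
      apply mul_le_mul <;> linarith
    have h2 : l * (l - y) ≤ 2 * α * l ^ 2 := by nlinarith
    have h3 : 2 * α * (l * (l - y)) ≤ 2 * α * (2 * α * l ^ 2) := by gcongr
    have h4 : 0 ≤ (2 * α - d) * (l * y) := mul_nonneg (by linarith) hly0.le
    have h5 : 0 ≤ 2 * α * (l * (l - y)) := by
      have := sub_nonneg.2 hyl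
      positivity
    rw [e, abs_of_nonneg (by linarith)]
    linarith
  set a := α ^ 2 * y with ha
  set b := (α + α ^ 2) * y with hb
  have ha0 : 0 < a := by positivity
  have hb0 : 0 < b := by positivity
  have hSa : |S - 1 - a / 2| ≤ a ^ 2 / 2 := by
    have hS1 : 1 ≤ S := by
      by_contra! h
      linarith [mul_pos (sub_pos.2 h) (by linarith : 0 < 1 + S)]
    have hSa' : S - 1 ≤ a := by linarith [mul_nonneg (sub_nonneg.2 hS1) hS0.le]
    have e : S - 1 - a / 2 = -((S - 1) ^ 2 / 2) := by linear_combination hS / 2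
    rw [e, abs_neg, abs_of_nonneg (by positivity)]
    gcongr
  have hquot : |S / (1 + b) - (1 - b + a / 2 + b ^ 2)| ≤ 10 * α ^ 3 * l ^ 2 := by
    have e : S / (1 + b) - (1 - b + a / 2 + b ^ 2)
        = ((S - 1 - a / 2) - (a * b / 2 + b ^ 3)) / (1 + b) := by
      field_simp
      ring
    have hb2 : b ≤ 2 * α * y := by rw [hb]; gcongr; linarith
    have h1 : a ^ 2 ≤ α ^ 3 * l ^ 2 := by
      calc a ^ 2 = α ^ 4 * y ^ 2 := by rw [ha]; ring
        _ ≤ _ := by gcongr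
    have h2 : a * b ≤ 2 * α ^ 3 * l ^ 2 := by
      calc a * b ≤ (α ^ 2 * y) * (2 * α * y) := by gcongr
        _ = 2 * α ^ 3 * y ^ 2 := by ring
        _ ≤ _ := by gcongr
    have h3 : b ^ 3 ≤ 8 * α ^ 3 * l ^ 2 := by
      calc b ^ 3 ≤ (2 * α * y) ^ 3 := by gcongr
        _ = 8 * α ^ 3 * (y ^ 2 * y) := by ring
        _ ≤ 8 * α ^ 3 * (l ^ 2 * 1) := by gcongr; linarith
        _ = _ := by ring
    have h4 : 0 < a * b / 2 + b ^ 3 := by positivity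
    rw [e, abs_div, abs_of_pos (by linarith : 0 < 1 + b)]
    refine (div_le_self (abs_nonneg _) (by linarith)).trans ((abs_sub _ _).trans ?_)
    rw [abs_of_pos h4]
    linarith
  have hsq : |y ^ 2 - l ^ 2| ≤ 4 * α * l ^ 2 := by
    rw [abs_sub_comm, abs_of_nonneg (by linarith)]
    nlinarith
  have hα2 : 0 < α ^ 2 := by positivity
  have f1 : α * |y - l + 2 * α * l ^ 2| ≤ α * (7 * α ^ 2 * l ^ 2) := by gcongr
  have f2 : α ^ 2 * |y ^ 2 - l ^ 2| ≤ α ^ 2 * (4 * α * l ^ 2) := by gcongr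
  have f3 : α ^ 2 * (l - y) ≤ α ^ 2 * (2 * α * l ^ 2) := by gcongr
  have f3' : 0 ≤ α ^ 2 * (l - y) := mul_nonneg hα2.le (by linarith)
  have f4 : (2 * α ^ 3 + α ^ 4) * y ^ 2 ≤ (2 * α ^ 3 + α ^ 3) * l ^ 2 := by gcongr
  have f4' : 0 ≤ (2 * α ^ 3 + α ^ 4) * y ^ 2 := by positivity
  rw [← abs_of_pos hα, ← abs_mul, abs_of_pos hα, abs_le] at f1
  rw [← abs_of_pos hα2, ← abs_mul, abs_of_pos hα2, abs_le] at f2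
  have key : S / (1 + b) - (1 - α * l - α ^ 2 * l / 2 + 3 * α ^ 2 * l ^ 2)
      = (S / (1 + b) - (1 - b + a / 2 + b ^ 2)) - α * (y - l + 2 * α * l ^ 2)
        + α ^ 2 * (l - y) / 2 + α ^ 2 * (y ^ 2 - l ^ 2) + (2 * α ^ 3 + α ^ 4) * y ^ 2 := by
    rw [ha, hb]; ring
  rw [key, abs_le]
  rw [abs_le] at hquot
  constructor <;> linarith [f1.1, f1.2, f2.1, f2.2, hquot.1, hquot.2]

/-- Expansion of `cos t / (1 + sin² t / α)` for the solution `t` of `(m + t) tan t = α`. -/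
theorem abs_cos_div_sub_expansion_le {α m t : ℝ} (hα : 0 < α) (hα1 : α < 1) (hm : 1 ≤ m)
    (ht0 : 0 < t) (ht : t < Real.pi / 2) (heq : (m + t) * Real.sin t = α * Real.cos t) :
    |Real.cos t / (1 + Real.sin t ^ 2 / α)
        - (1 - α / m ^ 2 - α ^ 2 / (2 * m ^ 2) + 3 * α ^ 2 / (m ^ 2) ^ 2)|
      ≤ 25 * α ^ 3 / (m ^ 2) ^ 2 := by
  have hc : 0 < Real.cos t := Real.cos_pos_of_mem_Ioo ⟨by linarith, ht⟩
  have htan : t * Real.cos t ≤ Real.sin t := by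
    have h := (Real.lt_tan ht0 ht).le
    rwa [Real.tan_eq_sin_div_cos, le_div_iff₀ hc] at h
  have hsin : Real.sin t ≤ t := (Real.sin_lt ht0).le
  have hpyth := Real.sin_sq_add_cos_sq t
  generalize Real.sin t = s at *
  generalize Real.cos t = c at *
  obtain ⟨x, hx⟩ : ∃ x, x = m + t := ⟨_, rfl⟩
  rw [← hx] at heq
  have hx1 : 1 ≤ x := by linarith
  have hx0 : 0 < x := by linarith
  have hm0 : 0 < m := by linarith
  have hxt : x * t ≤ α := by
    have : x * t * c ≤ α * c := by nlinarith
    exact le_of_mul_le_mul_right this hc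
  have htα : t ≤ α := by nlinarith
  have hs0 : 0 ≤ s := (mul_pos ht0 hc).le.trans htan
  have hc1 : c ≤ 1 := by nlinarith
  have hsα : s ≤ α := hsin.trans htα
  have hc2 : 1 - α ^ 2 ≤ c := by nlinarith
  have hxt' : α * (1 - α ^ 2) ≤ x * t := by
    calc α * (1 - α ^ 2) ≤ α * c := by gcongr
      _ = x * s := heq.symm
      _ ≤ _ := by gcongr
  have ht2 : t ^ 2 ≤ α ^ 2 := by gcongr
  have hd : x ^ 2 - m ^ 2 = 2 * (x * t) - t ^ 2 := by rw [hx]; ring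
  have hα32 : α ^ 3 ≤ α ^ 2 := by nlinarith [mul_pos hα hα]
  have hc2eq : c ^ 2 * (1 + α ^ 2 * (1 / x ^ 2)) = 1 := by
    field_simp
    have : (α * c) ^ 2 = (x * s) ^ 2 := by rw [heq]
    linear_combination this + x ^ 2 * hpyth
  have main := abs_quotient_sub_expansion_le (α := α) (l := 1 / m ^ 2) (y := 1 / x ^ 2)
    (S := c * (1 + α ^ 2 * (1 / x ^ 2))) (d := x ^ 2 - m ^ 2) hα hα1
    (by rw [div_le_one (by positivity)]; nlinarith) (by positivity)
    (by gcongr; linarith) (by nlinarith) (by nlinarith)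
    (by field_simp) (by positivity)
    (by linear_combination (1 + α ^ 2 * (1 / x ^ 2)) * hc2eq)
  have hQ : c / (1 + s ^ 2 / α)
      = c * (1 + α ^ 2 * (1 / x ^ 2)) / (1 + (α + α ^ 2) * (1 / x ^ 2)) := by
    have hs : s = α * c / x := by rw [eq_div_iff hx0.ne']; linarith
    have hs2 : s ^ 2 / α = α * (1 / x ^ 2) * c ^ 2 := by rw [hs]; field_simp
    have h0 : 0 < 1 + s ^ 2 / α := by positivity
    have h1 : 0 < 1 + (α + α ^ 2) * (1 / x ^ 2) := by positivity
    rw [div_eq_div_iff h0.ne' h1.ne', hs2]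
    linear_combination (-c * α * (1 / x ^ 2)) * hc2eq
  rw [hQ]
  convert main using 1
  · congr 1
    field_simp
  · field_simp


/-- Uniform asymptotics of the boundary products for `j ≥ 2`: with
`r j α ∈ ((j−1)π, (j−1/2)π)` the unique solution of `x·sin x = α·cos x`,
`P(j,α) := 2 cos(r j α)/(1 + sin²(r j α)/α)` and `λ_{j,0} := ((j−1)π)²`,
`(−1)^{j−1} P(j,α) = 2(1 − α/λ_{j,0} − α²/(2λ_{j,0}) + 3α²/λ_{j,0}²) + o(α²)/λ_{j,0}²`
as `α → 0⁺`, uniformly in `j ≥ 2`. -/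
theorem stmt_6 (r : ℕ → ℝ → ℝ)
    (hr : ∀ j : ℕ, 1 ≤ j → ∀ α : ℝ, 0 < α →
      r j α ∈ Set.Ioo (((j:ℝ) - 1) * Real.pi) (((j:ℝ) - 1/2) * Real.pi) ∧
      r j α * Real.sin (r j α) = α * Real.cos (r j α)) :
    ∃ η : ℝ → ℝ, (∀ α ∈ Set.Ioo (0:ℝ) 1, 0 ≤ η α) ∧
      Filter.Tendsto (fun α => η α / α ^ 2) (nhdsWithin 0 (Set.Ioi 0)) (nhds 0) ∧
      ∀ j : ℕ, 2 ≤ j → ∀ α ∈ Set.Ioo (0:ℝ) 1,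
        |(-1:ℝ) ^ (j - 1) * (2 * Real.cos (r j α) / (1 + Real.sin (r j α) ^ 2 / α))
            - 2 * (1 - α / ((((j:ℝ) - 1) * Real.pi) ^ 2)
                - α ^ 2 / (2 * (((j:ℝ) - 1) * Real.pi) ^ 2)
                + 3 * α ^ 2 / ((((j:ℝ) - 1) * Real.pi) ^ 2) ^ 2)|
          ≤ η α / ((((j:ℝ) - 1) * Real.pi) ^ 2) ^ 2 := by
  refine ⟨fun α => 50 * α ^ 3, fun α hα => by have := hα.1; positivity, ?_, ?_⟩
  · have h : Filter.Tendsto (fun α : ℝ => 50 * α) (nhdsWithin 0 (Set.Ioi 0)) (nhds 0) := by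
      have : Filter.Tendsto (fun α : ℝ => 50 * α) (nhds 0) (nhds (50 * 0)) :=
        (continuous_const.mul continuous_id).tendsto 0
      rw [mul_zero] at this
      exact this.mono_left nhdsWithin_le_nhds
    refine h.congr' ?_
    filter_upwards [self_mem_nhdsWithin] with α hα
    have : α ≠ 0 := ne_of_gt hα
    field_simp
  · intro j hj α hα
    obtain ⟨⟨h1, h2⟩, h3⟩ := hr j (by omega) α hα.1
    obtain ⟨k, rfl⟩ : ∃ k, j = k + 1 := ⟨j - 1, by omega⟩
    have hk : (1 : ℝ) ≤ k := by exact_mod_cast (by omega : 1 ≤ k)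
    have hcast : ((k + 1 : ℕ) : ℝ) - 1 = k := by push_cast; ring
    have hcast' : ((k + 1 : ℕ) : ℝ) - 1 / 2 = k + 1 / 2 := by push_cast; ring
    rw [hcast'] at h2
    rw [hcast] at h1 ⊢
    obtain ⟨t, ht⟩ : ∃ t, t = r (k + 1) α - k * Real.pi := ⟨_, rfl⟩
    have hrt : r (k + 1) α = t + k * Real.pi := by linarith
    rw [hrt, Real.sin_add_nat_mul_pi, Real.cos_add_nat_mul_pi] at h3
    rw [hrt, Real.sin_add_nat_mul_pi, Real.cos_add_nat_mul_pi, Nat.add_sub_cancel]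
    have hsign : ((-1 : ℝ) ^ k) * (-1) ^ k = 1 := by rw [← mul_pow]; norm_num
    have heq : (k * Real.pi + t) * Real.sin t = α * Real.cos t := by
      linear_combination (-1) ^ k * h3
        + (α * Real.cos t - (k * Real.pi + t) * Real.sin t) * hsign
    have hm : 1 ≤ k * Real.pi := by nlinarith [Real.pi_gt_three]
    have main := abs_cos_div_sub_expansion_le hα.1 hα.2 hm (by linarith) (by linarith) heq
    have e : (-1 : ℝ) ^ k * (2 * ((-1) ^ k * Real.cos t)
          / (1 + ((-1) ^ k * Real.sin t) ^ 2 / α))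
        = 2 * (Real.cos t / (1 + Real.sin t ^ 2 / α)) := by
      have hs : ((-1) ^ k * Real.sin t) ^ 2 = Real.sin t ^ 2 := by
        linear_combination Real.sin t ^ 2 * hsign
      rw [hs]
      linear_combination 2 * (Real.cos t / (1 + Real.sin t ^ 2 / α)) * hsign
    rw [e, ← mul_sub, abs_mul, abs_two]
    calc _ ≤ 2 * (25 * α ^ 3 / ((k * Real.pi) ^ 2) ^ 2) := by gcongr
      _ = _ := by ring
end

section
/- For k ∈ ℤ set μ_k := (k + 1/2)π. There exist constants C > 0 and ε > 0 such that for every k ∈ ℤ: | ∑_{j ∈ ℤ} (−1)^j / ( i·μ_k − (jπ)² ) | ≤ C·exp( −ε·√(1 + |k|) ). (The series converges absolutely since its terms are O(1/j²).) -/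
open Complex in
/-- The two-sided Mittag-Leffler expansion of the cotangent. -/
theorem hasSum_int_one_div_sq_sub_sq {x : ℂ} (hx : x ∈ integerComplement) :
    HasSum (fun j : ℤ ↦ 1 / (x ^ 2 - (j : ℂ) ^ 2)) (Real.pi * cot (Real.pi * x) / x) := by
  have hx0 : x ≠ 0 := integerComplement.ne_zero hx
  have h : HasSum (fun n : ℕ ↦ cotTerm x n) (Real.pi * cot (Real.pi * x) - 1 / x) :=
    cot_series_rep' hx ▸ (summable_cotTerm hx).hasSum
  have hpos : HasSum (fun n : ℕ ↦ 1 / (x ^ 2 - ((n : ℂ) + 1) ^ 2))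
      ((Real.pi * cot (Real.pi * x) - 1 / x) / (2 * x)) := by
    convert! h.div_const (2 * x) using 2 with n
    rw [cotTerm_identity hx, mul_div_cancel_left₀ _ (mul_ne_zero two_ne_zero hx0)]
    ring
  have hint := HasSum.of_add_one_of_neg_add_one
    (f := fun j : ℤ ↦ 1 / (x ^ 2 - (j : ℂ) ^ 2)) (by simpa using hpos)
    (m' := (Real.pi * cot (Real.pi * x) - 1 / x) / (2 * x))
    (by convert! hpos using 3 with n; push_cast; ring)
  convert! hint using 1
  push_cast
  field_simp
  ring

open Complex in
theorem Complex.cot_half_sub_cot {a : ℂ} (ha : sin a ≠ 0) :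
    cot (a / 2) - cot a = 1 / sin a := by
  obtain ⟨b, rfl⟩ : ∃ b, a = 2 * b := ⟨a / 2, by ring⟩
  rw [sin_two_mul] at ha
  have hs : sin b ≠ 0 := fun h ↦ ha (by simp [h])
  have hc : cos b ≠ 0 := fun h ↦ ha (by simp [h])
  rw [mul_div_cancel_left₀ _ two_ne_zero, cot, cot, sin_two_mul, cos_two_mul]
  field_simp
  ring

open Complex in
/-- The two-sided Mittag-Leffler expansion of the cosecant. -/
theorem hasSum_int_neg_one_zpow_div_sq_sub_sq {x : ℂ} (hx : x ∈ integerComplement) :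
    HasSum (fun j : ℤ ↦ (-1 : ℂ) ^ j / (x ^ 2 - (j : ℂ) ^ 2))
      (Real.pi / (x * sin (Real.pi * x))) := by
  have hx0 : x ≠ 0 := integerComplement.ne_zero hx
  have hx2 : x / 2 ∈ integerComplement := by
    rintro ⟨n, hn⟩
    exact hx ⟨2 * n, by push_cast; rw [hn]; ring⟩
  have heven : HasSum (fun j : ℤ ↦ if Even j then 1 / (x ^ 2 - (j : ℂ) ^ 2) else 0)
      (Real.pi * cot (Real.pi * (x / 2)) / (x / 2) / 4) := by
    have hinj : Function.Injective (fun m : ℤ ↦ 2 * m) := fun a b h ↦ by simpa using h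
    rw [← hinj.hasSum_iff]
    · convert! (hasSum_int_one_div_sq_sub_sq hx2).div_const 4 using 2 with m
      simp only [Function.comp_apply, even_two_mul, if_true, div_div]
      push_cast
      ring
    · intro j hj
      refine if_neg fun he ↦ hj ?_
      obtain ⟨m, hm⟩ := he
      exact ⟨m, by simp only; omega⟩
  have hsum := (heven.mul_left 2).sub (hasSum_int_one_div_sq_sub_sq hx)
  convert! hsum using 1
  · ext j
    by_cases hj : Even j
    · simp only [hj.neg_one_zpow, hj, if_true]
      ring
    · simp only [(Int.not_even_iff_odd.mp hj).neg_one_zpow, hj, if_false]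
      ring
  · have hs : sin (Real.pi * x) ≠ 0 := sin_pi_mul_ne_zero hx
    have h := cot_half_sub_cot hs
    rw [← mul_div_assoc]
    rw [show (Real.pi : ℂ) / (x * sin (Real.pi * x))
      = Real.pi / x * (1 / sin (Real.pi * x)) by field_simp, ← h]
    field_simp
    ring

open Complex in
theorem Complex.abs_sinh_im_le_norm_sin (w : ℂ) : |Real.sinh w.im| ≤ ‖sin w‖ := by
  have h := abs_norm_sub_norm_le (exp (-w * I)) (exp (w * I))
  simp only [norm_exp, mul_re, neg_re, neg_im, I_re, I_im, mul_zero, mul_one, zero_sub,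
    neg_neg] at h
  rw [sin, Real.sinh_eq, norm_div, norm_mul, norm_I, mul_one, abs_div, norm_ofNat, abs_two]
  gcongr

theorem Real.exp_div_four_le_sinh {s : ℝ} (hs : 1 / 2 ≤ s) : exp s / 4 ≤ sinh s := by
  have h2 : 2 ≤ exp (2 * s) := by linarith [add_one_le_exp (2 * s)]
  have h : exp (-s) * exp (2 * s) = exp s := by rw [← exp_add]; ring_nf
  rw [sinh_eq]
  nlinarith [exp_pos (-s)]

open Complex in
/-- `w = s (1 ± i)` is a square root of `iμ`, where `s² = |μ| / 2`. -/
theorem exists_sq_eq_I_mul (μ : ℝ) :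
    ∃ w : ℂ, w ^ 2 = I * μ ∧ |w.im| = √(|μ| / 2) := by
  have hs : √(|μ| / 2) ^ 2 = |μ| / 2 := Real.sq_sqrt (by positivity)
  rcases le_total 0 μ with h | h
  · refine ⟨⟨√(|μ| / 2), √(|μ| / 2)⟩, ?_, abs_of_nonneg (Real.sqrt_nonneg _)⟩
    rw [abs_of_nonneg h] at *
    apply Complex.ext <;> simp only [sq, mul_re, mul_im, I_re, I_im, ofReal_re, ofReal_im] <;>
      nlinarith
  · refine ⟨⟨√(|μ| / 2), -√(|μ| / 2)⟩, ?_, by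
      rw [abs_neg, abs_of_nonneg (Real.sqrt_nonneg _)]⟩
    rw [abs_of_nonpos h] at *
    apply Complex.ext <;> simp only [sq, mul_re, mul_im, I_re, I_im, ofReal_re, ofReal_im] <;>
      nlinarith

open Complex in
/-- The residue formula `∑ (-1)^j / (w² - (jπ)²) = 1 / (w sin w)` off the real axis. -/
theorem tsum_neg_one_zpow_div_sq_sub_sq {w : ℂ} (hw : w.im ≠ 0) :
    ∑' j : ℤ, (-1 : ℂ) ^ j / (w ^ 2 - ((((j : ℝ) * Real.pi) ^ 2 : ℝ) : ℂ))
      = 1 / (w * sin w) := by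
  have hpi : (Real.pi : ℂ) ≠ 0 := ofReal_ne_zero.mpr Real.pi_ne_zero
  have hx : w / Real.pi ∈ integerComplement := by
    rintro ⟨n, hn⟩
    apply hw
    rw [eq_div_iff hpi] at hn
    simp [← hn]
  have h := (hasSum_int_neg_one_zpow_div_sq_sub_sq hx).div_const ((Real.pi : ℂ) ^ 2)
  rw [mul_div_cancel₀ _ hpi] at h
  convert! h.tsum_eq using 1
  · refine tsum_congr fun j ↦ ?_
    rw [div_div]
    congr 1
    push_cast
    field_simp
  · field_simp

theorem norm_one_div_mul_sin_le {w : ℂ} (hw : 1 / 2 ≤ |w.im|) :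
    ‖1 / (w * Complex.sin w)‖ ≤ 8 * Real.exp (-|w.im|) := by
  have hsin : Real.exp |w.im| / 4 ≤ ‖Complex.sin w‖ :=
    ((Real.exp_div_four_le_sinh hw).trans (Real.abs_sinh _).ge).trans
      w.abs_sinh_im_le_norm_sin
  have hmul : 1 / 2 * (Real.exp |w.im| / 4) ≤ ‖w‖ * ‖Complex.sin w‖ :=
    mul_le_mul (hw.trans w.abs_im_le_norm) hsin (by positivity) (norm_nonneg _)
  rw [norm_div, norm_one, norm_mul, Real.exp_neg]
  refine (one_div_le_one_div_of_le (by positivity) hmul).trans_eq ?_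
  field_simp
  norm_num

theorem one_add_abs_div_four_le_abs_add_half (k : ℤ) :
    (1 + |(k : ℝ)|) / 4 ≤ |(k : ℝ) + 1 / 2| := by
  rcases le_or_gt 0 k with h | h
  · have hk : (0 : ℝ) ≤ k := by exact_mod_cast h
    rw [abs_of_nonneg hk, abs_of_nonneg (by linarith)]
    linarith
  · have hk : (k : ℝ) ≤ -1 := by exact_mod_cast Int.le_sub_one_of_lt h
    rw [abs_of_nonpos (by linarith), abs_of_nonpos (by linarith)]
    linarith

/-- Residue estimate: with `μ_k = (k+1/2)π`,
`|∑_{j∈ℤ} (−1)^j/(i μ_k − (jπ)²)| ≤ C e^{−ε√(1+|k|)}`. -/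
theorem stmt_7 :
    ∃ C > (0:ℝ), ∃ ε > (0:ℝ), ∀ k : ℤ,
      ‖∑' j : ℤ, (-1 : ℂ) ^ j /
          (Complex.I * ((((k:ℝ) + 1/2) * Real.pi : ℝ) : ℂ)
            - ((((j:ℝ) * Real.pi) ^ 2 : ℝ) : ℂ))‖
        ≤ C * Real.exp (-ε * Real.sqrt (1 + |(k:ℝ)|)) := by
  refine ⟨8, by norm_num, 1 / 2, by norm_num, fun k ↦ ?_⟩
  obtain ⟨w, hw, him⟩ := exists_sq_eq_I_mul (((k : ℝ) + 1 / 2) * Real.pi)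
  have hle : 1 / 2 * √(1 + |(k : ℝ)|) ≤ |w.im| := by
    rw [him]
    apply Real.le_sqrt_of_sq_le
    rw [mul_pow, Real.sq_sqrt (by positivity), abs_mul, abs_of_pos Real.pi_pos]
    nlinarith [one_add_abs_div_four_le_abs_add_half k, Real.two_le_pi,
      abs_nonneg ((k : ℝ) + 1 / 2)]
  have hone : 1 ≤ √(1 + |(k : ℝ)|) := Real.one_le_sqrt.mpr (by simp)
  have hhalf : 1 / 2 ≤ |w.im| := by linarith
  rw [← hw, tsum_neg_one_zpow_div_sq_sub_sq (abs_pos.mp (by linarith))]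
  refine (norm_one_div_mul_sin_le hhalf).trans ?_
  gcongr
  linarith
end

section
/- For k ∈ ℤ set μ_k := (k + 1/2)π. There exists a constant C > 0 such that for every k ∈ ℤ: | ∑_{j ∈ ℤ, j ≠ 0} (−1)^j / ( (jπ)² · ( i·μ_k − (jπ)² ) ) + 1/(6·i·μ_k) | ≤ C / μ_k². That is, the series equals −1/(6 i μ_k) + O(1/μ_k²) as |k| → ∞. -/
open Filter Topology

/-- The alternating Basel sum `∑ (-1)^n / n² = -π²/12`. -/
lemma hasSum_neg_one_pow_div_sq :
    HasSum (fun n : ℕ => (-1 : ℝ) ^ n / (n : ℝ) ^ 2) (-(Real.pi ^ 2 / 12)) := by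
  have hz := hasSum_zeta_two
  have he : HasSum (fun n : ℕ => 1 / ((2 * n : ℕ) : ℝ) ^ 2) (Real.pi ^ 2 / 24) := by
    convert hz.mul_left (1 / 4 : ℝ) using 1
    · rfl
    · funext n
      push_cast
      rw [mul_pow, ← one_div_mul_one_div]
      norm_num
    · ring
  have hso : Summable (fun n : ℕ => 1 / ((2 * n + 1 : ℕ) : ℝ) ^ 2) :=
    hz.summable.comp_injective (i := fun n : ℕ => 2 * n + 1) fun a b h => by
      simp only at h
      omega
  obtain ⟨s, hs⟩ := hso
  have hs_eq : Real.pi ^ 2 / 24 + s = Real.pi ^ 2 / 6 :=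
    (HasSum.even_add_odd (f := fun n : ℕ => 1 / (n : ℝ) ^ 2) he hs).unique hz
  have he' : HasSum (fun n : ℕ => (-1 : ℝ) ^ (2 * n) / ((2 * n : ℕ) : ℝ) ^ 2)
      (Real.pi ^ 2 / 24) := by
    simpa [pow_mul] using he
  have ho' : HasSum (fun n : ℕ => (-1 : ℝ) ^ (2 * n + 1) / ((2 * n + 1 : ℕ) : ℝ) ^ 2) (-s) := by
    convert hs.neg using 1
    · rfl
    · funext n
      simp [pow_succ, pow_mul, neg_div]
  convert HasSum.even_add_odd (f := fun n : ℕ => (-1 : ℝ) ^ n / (n : ℝ) ^ 2) he' ho' using 1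
  linarith

/-- An alternating series whose consecutive differences are dominated by those of a
nonnegative antitone sequence `b` is bounded by `b 0`. -/
lemma norm_le_of_hasSum_alternating {E : Type*} [NormedRing E] {f : ℕ → E} {b : ℕ → ℝ} {s : E}
    (hs : HasSum (fun n => (-1 : E) ^ n * f n) s) (hb : Antitone b) (hb0 : ∀ n, 0 ≤ b n)
    (hf : ∀ n, ‖f n - f (n + 1)‖ ≤ b n - b (n + 1)) : ‖s‖ ≤ b 0 := by
  have hpartial : ∀ N : ℕ, ‖∑ i ∈ Finset.range (2 * N), (-1 : E) ^ i * f i‖ ≤ b 0 - b (2 * N) := by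
    intro N
    induction N with
    | zero => simp
    | succ N ih =>
      have h2 : ∑ i ∈ Finset.range (2 * (N + 1)), (-1 : E) ^ i * f i
          = ∑ i ∈ Finset.range (2 * N), (-1 : E) ^ i * f i + (f (2 * N) - f (2 * N + 1)) := by
        rw [show 2 * (N + 1) = 2 * N + 1 + 1 by ring, Finset.sum_range_succ,
          Finset.sum_range_succ]
        simp [pow_succ, pow_mul, add_assoc, sub_eq_add_neg]
      rw [h2]
      have h3 := hb (Nat.le_succ (2 * N + 1))
      have h4 := norm_add_le (∑ i ∈ Finset.range (2 * N), (-1 : E) ^ i * f i)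
        (f (2 * N) - f (2 * N + 1))
      rw [show 2 * (N + 1) = (2 * N + 1).succ by rw [Nat.succ_eq_add_one]; ring]
      linarith [hf (2 * N)]
  have ht : Tendsto (fun N : ℕ => ∑ i ∈ Finset.range (2 * N), (-1 : E) ^ i * f i) atTop (𝓝 s) :=
    hs.tendsto_sum_nat.comp (tendsto_id.const_mul_atTop' (by norm_num))
  exact le_of_tendsto ht.norm (Eventually.of_forall fun N =>
    (hpartial N).trans (sub_le_self _ (hb0 _)))

lemma abs_add_le_two_mul_norm_I_mul_sub (μ a : ℝ) :
    (|μ| + a) ^ 2 ≤ 2 * ‖Complex.I * (μ : ℂ) - (a : ℂ)‖ ^ 2 := by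
  have : ‖Complex.I * (μ : ℂ) - (a : ℂ)‖ ^ 2 = μ ^ 2 + a ^ 2 := by
    rw [← Complex.normSq_eq_norm_sq, Complex.normSq_apply]
    simp
    ring
  rw [this, ← sq_abs μ]
  nlinarith [sq_nonneg (|μ| - a)]

lemma I_mul_sub_ofReal_ne_zero {μ : ℝ} (hμ : μ ≠ 0) (a : ℝ) :
    Complex.I * (μ : ℂ) - (a : ℂ) ≠ 0 := by
  intro h
  have := congrArg Complex.im h
  simp at this
  exact hμ this

lemma norm_inv_I_mul_sub_sub_inv_le {μ : ℝ} (hμ : μ ≠ 0) {a b : ℝ} (ha : 0 ≤ a) (hab : a ≤ b) :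
    ‖1 / (Complex.I * (μ : ℂ) - (a : ℂ)) - 1 / (Complex.I * (μ : ℂ) - (b : ℂ))‖
      ≤ 2 / (|μ| + a) - 2 / (|μ| + b) := by
  have hna := I_mul_sub_ofReal_ne_zero hμ a
  have hnb := I_mul_sub_ofReal_ne_zero hμ b
  have hm : 0 < |μ| := abs_pos.mpr hμ
  have hA : 0 < |μ| + a := by linarith
  have hB : 0 < |μ| + b := by linarith
  have h1 := abs_add_le_two_mul_norm_I_mul_sub μ a
  have h2 := abs_add_le_two_mul_norm_I_mul_sub μ b
  have e1 : 1 / (Complex.I * (μ : ℂ) - (a : ℂ)) - 1 / (Complex.I * (μ : ℂ) - (b : ℂ))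
      = ((a - b : ℝ) : ℂ) /
        ((Complex.I * (μ : ℂ) - (a : ℂ)) * (Complex.I * (μ : ℂ) - (b : ℂ))) := by
    rw [div_sub_div _ _ hna hnb]
    push_cast
    ring
  have e2 : 2 / (|μ| + a) - 2 / (|μ| + b) = (b - a) / ((|μ| + a) * (|μ| + b) / 2) := by
    field_simp
    ring
  rw [e1, e2, norm_div, norm_mul, Complex.norm_real, Real.norm_eq_abs, abs_sub_comm,
    abs_of_nonneg (sub_nonneg.mpr hab)]
  refine div_le_div_of_nonneg_left (sub_nonneg.mpr hab) (by positivity) ?_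
  have h3 : ((|μ| + a) * (|μ| + b)) ^ 2 ≤ (2 * (‖Complex.I * (μ : ℂ) - (a : ℂ)‖ *
      ‖Complex.I * (μ : ℂ) - (b : ℂ)‖)) ^ 2 := by
    calc _ = (|μ| + a) ^ 2 * (|μ| + b) ^ 2 := by ring
      _ ≤ _ := mul_le_mul h1 h2 (by positivity) (by positivity)
      _ = _ := by ring
  have h4 := le_of_abs_le (abs_le_of_sq_le_sq h3 (by positivity))
  linarith

/-- The summand `(-1)^j / ((jπ)² (iμ - (jπ)²))`, equal to `0` at `j = 0`. -/
noncomputable def modalTerm (μ : ℝ) (j : ℤ) : ℂ :=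
  (-1 : ℂ) ^ j / ((((j : ℝ) * Real.pi) ^ 2 : ℝ) *
    (Complex.I * (μ : ℂ) - ((((j : ℝ) * Real.pi) ^ 2 : ℝ) : ℂ)))

lemma modalTerm_neg (μ : ℝ) (j : ℤ) : modalTerm μ (-j) = modalTerm μ j := by
  have h : (-1 : ℂ) ^ (-j) = (-1) ^ j := by
    rw [zpow_neg, ← inv_zpow, inv_neg_one]
  simp only [modalTerm, h, Int.cast_neg, neg_mul, neg_sq]

lemma modalTerm_zero (μ : ℝ) : modalTerm μ 0 = 0 := by
  simp [modalTerm]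

lemma summable_modalTerm_nat {μ : ℝ} (hμ : μ ≠ 0) :
    Summable (fun n : ℕ => modalTerm μ ((n : ℤ) + 1)) := by
  have hz : Summable (fun n : ℕ => 1 / ((n + 1 : ℕ) : ℝ) ^ 2) :=
    (summable_nat_add_iff 1).mpr hasSum_zeta_two.summable
  refine Summable.of_norm_bounded (hz.mul_left (1 / (Real.pi ^ 2 * |μ|))) fun n => ?_
  have hm : 0 < |μ| := abs_pos.mpr hμ
  have hle : |μ| ≤ ‖Complex.I * (μ : ℂ) -
      (((((n : ℤ) + 1 : ℤ) : ℝ) * Real.pi) ^ 2 : ℝ)‖ := by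
    refine le_trans (le_of_eq ?_) (Complex.abs_im_le_norm _)
    rw [Complex.sub_im, Complex.ofReal_im]
    simp
  have hpi := Real.pi_pos
  unfold modalTerm
  rw [norm_div, norm_zpow, norm_neg, norm_one, one_zpow, norm_mul, Complex.norm_real,
    Real.norm_eq_abs, abs_of_nonneg (sq_nonneg _), div_mul_div_comm, one_mul]
  refine div_le_div_of_nonneg_left zero_le_one (by positivity) ?_
  calc Real.pi ^ 2 * |μ| * ((n + 1 : ℕ) : ℝ) ^ 2
      = ((((n : ℤ) + 1 : ℤ) : ℝ) * Real.pi) ^ 2 * |μ| := by push_cast; ring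
    _ ≤ _ := mul_le_mul_of_nonneg_left hle (sq_nonneg _)

lemma tsum_modalTerm {μ : ℝ} (hμ : μ ≠ 0) :
    ∑' j : {j : ℤ // j ≠ 0}, modalTerm μ j = 2 * ∑' n : ℕ, modalTerm μ ((n : ℤ) + 1) := by
  have h := (summable_modalTerm_nat hμ).hasSum
  have hneg : HasSum (fun n : ℕ => modalTerm μ (-((n : ℤ) + 1)))
      (∑' n : ℕ, modalTerm μ ((n : ℤ) + 1)) := by
    simpa only [modalTerm_neg] using h
  have hint := HasSum.of_add_one_of_neg_add_one h hneg
  have hsub : HasSum (fun j : {j : ℤ // j ≠ 0} => modalTerm μ j) _ :=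
    (hasSum_subtype_iff_of_support_subset (s := {j : ℤ | j ≠ 0}) (by
      intro j hj h0
      exact hj (by rw [h0, modalTerm_zero]))).mpr hint
  rw [hsub.tsum_eq, modalTerm_zero]
  ring

lemma norm_tsum_modalTerm_add_le {μ : ℝ} (hμ : μ ≠ 0) :
    ‖(∑' n : ℕ, modalTerm μ ((n : ℤ) + 1)) + 1 / (12 * (Complex.I * μ))‖ ≤ 2 / μ ^ 2 := by
  set a : ℕ → ℝ := fun n => (((n : ℝ) + 1) * Real.pi) ^ 2 with ha
  have hm : 0 < |μ| := abs_pos.mpr hμ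
  have hpi := Real.pi_pos
  have hpos : ∀ n, 0 < a n := fun n => by positivity
  have hmono : Monotone a := fun m n hmn => by
    have : (m : ℝ) ≤ n := by exact_mod_cast hmn
    simp only [ha]
    gcongr
  have halt : HasSum (fun n : ℕ => (-1 : ℂ) ^ n * (1 / (a n : ℂ))) (1 / 12) := by
    have h1 := (hasSum_nat_add_iff' 1).mpr hasSum_neg_one_pow_div_sq
    have h2 := (h1.mul_left (-(1 / Real.pi ^ 2))).mapL Complex.ofRealCLM
    convert h2 using 1
    · funext n
      simp only [ha, Complex.ofRealCLM_apply]
      push_cast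
      field_simp
      ring
    · simp only [Complex.ofRealCLM_apply]
      have : (Real.pi : ℂ) ≠ 0 := by exact_mod_cast hpi.ne'
      push_cast
      simp
      field_simp
  have hsum : HasSum (fun n : ℕ => (-1 : ℂ) ^ n * (1 / (Complex.I * μ - a n)))
      (-(Complex.I * μ) * ((∑' n : ℕ, modalTerm μ ((n : ℤ) + 1)) +
        1 / (12 * (Complex.I * μ)))) := by
    convert ((summable_modalTerm_nat hμ).hasSum.mul_left (-(Complex.I * μ))).sub halt using 1
    · rfl
    · funext n
      have h1 := I_mul_sub_ofReal_ne_zero hμ (a n)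
      have h2 : (a n : ℂ) ≠ 0 := by exact_mod_cast (hpos n).ne'
      have h3 : modalTerm μ ((n : ℤ) + 1) =
          -(-1) ^ n / ((a n : ℂ) * (Complex.I * μ - a n)) := by
        have : (-1 : ℂ) ^ ((n : ℤ) + 1) = -(-1) ^ n := by
          rw [zpow_add₀ (by norm_num)]
          simp
        simp [modalTerm, this, ha]
      rw [h3]
      field_simp
      ring
    · have hc : (μ : ℂ) ≠ 0 := by exact_mod_cast hμ
      field_simp
      ring
  have hbound := norm_le_of_hasSum_alternating (b := fun n => 2 / (|μ| + a n)) hsum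
    (fun m n hmn => by
      have := hmono hmn
      have := hpos m
      simp only
      gcongr)
    (fun n => by have := hpos n; positivity)
    (fun n => norm_inv_I_mul_sub_sub_inv_le hμ (hpos n).le (hmono n.le_succ))
  rw [norm_mul, norm_neg, norm_mul, Complex.norm_I, one_mul, Complex.norm_real,
    Real.norm_eq_abs] at hbound
  have hb2 : 2 / (|μ| + a 0) ≤ 2 / |μ| := by
    have := hpos 0
    gcongr
    linarith
  rw [← sq_abs μ, le_div_iff₀ (by positivity)]
  have h6 := hbound.trans hb2
  rw [le_div_iff₀ hm] at h6
  linarith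

/-- With `μ_k = (k+1/2)π`, the series `∑_{j∈ℤ, j≠0} (−1)^j/((jπ)²(iμ_k − (jπ)²))`
equals `−1/(6 i μ_k) + O(1/μ_k²)`. -/
theorem stmt_8 :
    ∃ C > (0:ℝ), ∀ k : ℤ,
      ‖(∑' j : {j : ℤ // j ≠ 0},
          (-1 : ℂ) ^ (j : ℤ) /
            (((((j : ℤ) : ℝ) * Real.pi) ^ 2 : ℝ) *
              (Complex.I * ((((k:ℝ) + 1/2) * Real.pi : ℝ) : ℂ)
                - (((((j : ℤ) : ℝ) * Real.pi) ^ 2 : ℝ) : ℂ))))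
        + 1 / (6 * Complex.I * ((((k:ℝ) + 1/2) * Real.pi : ℝ) : ℂ))‖
        ≤ C / (((k:ℝ) + 1/2) * Real.pi) ^ 2 := by
  refine ⟨4, by norm_num, fun k => ?_⟩
  have hμ : ((k : ℝ) + 1 / 2) * Real.pi ≠ 0 := by
    refine mul_ne_zero (fun h => ?_) Real.pi_ne_zero
    have h2 : ((2 * k + 1 : ℤ) : ℝ) = 0 := by
      push_cast
      linarith
    have h3 : 2 * k + 1 = 0 := by exact_mod_cast h2
    omega
  generalize ((k : ℝ) + 1 / 2) * Real.pi = μ at hμ ⊢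
  change ‖(∑' j : {j : ℤ // j ≠ 0}, modalTerm μ j) + 1 / (6 * Complex.I * (μ : ℂ))‖ ≤ _
  have e : (∑' j : {j : ℤ // j ≠ 0}, modalTerm μ j) + 1 / (6 * Complex.I * (μ : ℂ)) =
      2 * ((∑' n : ℕ, modalTerm μ ((n : ℤ) + 1)) + 1 / (12 * (Complex.I * μ))) := by
    rw [tsum_modalTerm hμ]
    have hc : (μ : ℂ) ≠ 0 := by exact_mod_cast hμ
    field_simp
    ring
  rw [e, norm_mul, Complex.norm_ofNat]
  calc _ ≤ 2 * (2 / μ ^ 2) := mul_le_mul_of_nonneg_left (norm_tsum_modalTerm_add_le hμ) (by norm_num)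
    _ = 4 / μ ^ 2 := by ring
end

section
/- For k ∈ ℤ set μ_k := (k + 1/2)π. There exists a constant C > 0 such that for every k ∈ ℤ: | ∑_{j ∈ ℤ, j ≠ 0} (−1)^j / ( (jπ)⁴ · ( i·μ_k − (jπ)² ) ) + 7/(360·i·μ_k) | ≤ C / μ_k². That is, the series equals −7/(360 i μ_k) + O(1/μ_k²) as |k| → ∞. -/
theorem hasSum_nat_neg_one_pow_div_pow_four :
    HasSum (fun n : ℕ => (-1 : ℝ) ^ n / (n : ℝ) ^ 4) (-7 * Real.pi ^ 4 / 720) := by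
  have h := hasSum_zeta_four
  have he : HasSum (fun n : ℕ => 1 / ((2 * n : ℕ) : ℝ) ^ 4) (1 / 16 * (Real.pi ^ 4 / 90)) := by
    refine (h.mul_left (1 / 16)).congr_fun fun n => ?_
    push_cast
    rw [mul_pow, one_div_mul_one_div]
    norm_num
  have ho : Summable fun n : ℕ => 1 / ((2 * n + 1 : ℕ) : ℝ) ^ 4 :=
    h.summable.comp_injective (i := fun n : ℕ => 2 * n + 1) fun a b hab => by simpa using hab
  have hsum := (he.even_add_odd ho.hasSum (f := fun n : ℕ => 1 / (n : ℝ) ^ 4)).unique h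
  have key := HasSum.even_add_odd (f := fun n : ℕ => (-1 : ℝ) ^ n / (n : ℝ) ^ 4)
    (m := 1 / 16 * (Real.pi ^ 4 / 90)) (m' := -∑' n : ℕ, 1 / ((2 * n + 1 : ℕ) : ℝ) ^ 4)
    (by simpa [pow_mul] using he)
    (by simpa [pow_add, pow_mul, neg_div] using ho.hasSum.neg)
  convert key using 1
  linarith

theorem hasSum_int_neg_one_zpow_div_pow_four :
    HasSum (fun j : ℤ => (-1 : ℂ) ^ j / ((((j : ℝ) * Real.pi) ^ 4 : ℝ) : ℂ)) (-7 / 360) := by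
  have hpi : (Real.pi : ℂ) ≠ 0 := by exact_mod_cast Real.pi_ne_zero
  have h : HasSum (fun n : ℕ => (-1 : ℂ) ^ n / ((((n : ℝ) * Real.pi) ^ 4 : ℝ) : ℂ))
      (-7 / 720) := by
    have hval : (-7 / 720 : ℂ) =
        ((-7 * Real.pi ^ 4 / 720 : ℝ) : ℂ) * ((Real.pi : ℂ) ^ 4)⁻¹ := by
      push_cast
      field_simp
    rw [hval]
    refine ((Complex.hasSum_ofReal.mpr hasSum_nat_neg_one_pow_div_pow_four).mul_right
      ((Real.pi : ℂ) ^ 4)⁻¹).congr_fun fun n => ?_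
    push_cast
    rw [mul_pow, div_mul_eq_div_div, div_eq_mul_inv _ ((Real.pi : ℂ) ^ 4)]
  have key := HasSum.of_nat_of_neg
    (f := fun j : ℤ => (-1 : ℂ) ^ j / ((((j : ℝ) * Real.pi) ^ 4 : ℝ) : ℂ))
    (g := -7 / 720) (g' := -7 / 720)
    (by simpa using h)
    (by
      refine h.congr_fun fun n => ?_
      rw [zpow_neg, zpow_natCast, ← inv_pow, inv_neg, inv_one]
      push_cast
      ring)
  have hval : (-7 / 360 : ℂ) =
      -7 / 720 + -7 / 720 - (-1) ^ (0 : ℤ) / (((((0 : ℤ) : ℝ) * Real.pi) ^ 4 : ℝ) : ℂ) := by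
    norm_num
  rw [hval]
  exact key

theorem summable_int_one_div_mul_pi_sq :
    Summable fun j : ℤ => 1 / ((j : ℝ) * Real.pi) ^ 2 := by
  have h := (Real.summable_one_div_int_pow.mpr one_lt_two).mul_right (1 / Real.pi ^ 2)
  refine h.congr fun j => ?_
  rw [mul_pow, one_div_mul_one_div]

theorem abs_le_norm_I_mul_sub (m a : ℝ) : |m| ≤ ‖Complex.I * (m : ℂ) - (a : ℂ)‖ := by
  simpa using Complex.abs_im_le_norm (Complex.I * (m : ℂ) - (a : ℂ))

/-- For real `m ≠ 0`, the resolvent series differs from its leading term by `O(1 / m ^ 2)`. -/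
theorem norm_tsum_resolvent_add_le {m : ℝ} (hm : m ≠ 0) :
    ‖(∑' j : {j : ℤ // j ≠ 0}, (-1 : ℂ) ^ (j : ℤ) /
          (((((j : ℤ) : ℝ) * Real.pi) ^ 4 : ℝ) *
            (Complex.I * (m : ℂ) - (((((j : ℤ) : ℝ) * Real.pi) ^ 2 : ℝ) : ℂ))))
        + 7 / (360 * Complex.I * (m : ℂ))‖
      ≤ (∑' j : ℤ, 1 / ((j : ℝ) * Real.pi) ^ 2) / m ^ 2 := by
  have hmC : (m : ℂ) ≠ 0 := by exact_mod_cast hm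
  have hden (a : ℝ) : Complex.I * (m : ℂ) - (a : ℂ) ≠ 0 :=
    norm_pos_iff.mp ((abs_pos.mpr hm).trans_le (abs_le_norm_I_mul_sub m a))
  set T : ℤ → ℂ := fun j => (-1 : ℂ) ^ j / (((((j : ℝ) * Real.pi) ^ 4 : ℝ) : ℂ) *
    (Complex.I * (m : ℂ) - ((((j : ℝ) * Real.pi) ^ 2 : ℝ) : ℂ))) with hT
  set R : ℤ → ℂ := fun j => (-1 : ℂ) ^ j / (((((j : ℝ) * Real.pi) ^ 2 : ℝ) : ℂ) *
    ((Complex.I * (m : ℂ)) *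
      (Complex.I * (m : ℂ) - ((((j : ℝ) * Real.pi) ^ 2 : ℝ) : ℂ)))) with hR
  have hRle (j : ℤ) : ‖R j‖ ≤ 1 / ((j : ℝ) * Real.pi) ^ 2 / m ^ 2 := by
    have hn : m ^ 2 ≤ |m| * ‖Complex.I * (m : ℂ) - ((((j : ℝ) * Real.pi) ^ 2 : ℝ) : ℂ)‖ := by
      rw [← sq_abs, sq]
      exact mul_le_mul_of_nonneg_left (abs_le_norm_I_mul_sub m _) (abs_nonneg m)
    simp only [hR, norm_div, norm_mul, norm_zpow, norm_neg, norm_one, one_zpow, Complex.norm_I,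
      one_mul, Complex.norm_real, Real.norm_eq_abs, abs_pow, sq_abs]
    rw [← div_div]
    exact div_le_div_of_nonneg_left (by positivity) (by positivity) hn
  have hB := summable_int_one_div_mul_pi_sq.div_const (m ^ 2)
  have hRs : Summable R := .of_norm_bounded hB hRle
  have hTeq (j : ℤ) : T j =
      (-1 : ℂ) ^ j / ((((j : ℝ) * Real.pi) ^ 4 : ℝ) : ℂ) / (Complex.I * (m : ℂ)) + R j := by
    rcases eq_or_ne j 0 with rfl | hj
    · simp [hT, hR]
    · have hx : (((j : ℝ) * Real.pi : ℝ) : ℂ) ≠ 0 := by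
        exact_mod_cast mul_ne_zero (Int.cast_ne_zero.mpr hj) Real.pi_ne_zero
      have hd := hden (((j : ℝ) * Real.pi) ^ 2)
      simp only [hT, hR]
      generalize (j : ℝ) * Real.pi = x at hx hd
      generalize (-1 : ℂ) ^ j = s
      push_cast at hd ⊢
      have hI := Complex.I_ne_zero
      generalize Complex.I = i at hd hI
      field_simp
      ring
  have hTs : HasSum T (-7 / 360 / (Complex.I * (m : ℂ)) + ∑' j, R j) :=
    ((hasSum_int_neg_one_zpow_div_pow_four.div_const _).add hRs.hasSum).congr_fun hTeq
  have hsub : ∑' j : {j : ℤ // j ≠ 0}, T j = ∑' j, T j :=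
    tsum_subtype_eq_of_support_subset (s := {j : ℤ | j ≠ 0}) fun j hj => by
      rintro rfl
      simp [hT] at hj
  change ‖(∑' j : {j : ℤ // j ≠ 0}, T j) + _‖ ≤ _
  have hsimp : -7 / 360 / (Complex.I * (m : ℂ)) + ∑' j, R j + 7 / (360 * Complex.I * (m : ℂ))
      = ∑' j, R j := by
    field_simp
    ring
  rw [hsub, hTs.tsum_eq, hsimp, ← tsum_div_const]
  exact tsum_of_norm_bounded hB.hasSum hRle


/-- With `μ_k = (k+1/2)π`, the series `∑_{j∈ℤ, j≠0} (−1)^j/((jπ)⁴(iμ_k − (jπ)²))`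
equals `−7/(360 i μ_k) + O(1/μ_k²)`. -/
theorem stmt_9 :
    ∃ C > (0:ℝ), ∀ k : ℤ,
      ‖(∑' j : {j : ℤ // j ≠ 0},
          (-1 : ℂ) ^ (j : ℤ) /
            (((((j : ℤ) : ℝ) * Real.pi) ^ 4 : ℝ) *
              (Complex.I * ((((k:ℝ) + 1/2) * Real.pi : ℝ) : ℂ)
                - (((((j : ℤ) : ℝ) * Real.pi) ^ 2 : ℝ) : ℂ))))
        + 7 / (360 * Complex.I * ((((k:ℝ) + 1/2) * Real.pi : ℝ) : ℂ))‖
        ≤ C / (((k:ℝ) + 1/2) * Real.pi) ^ 2 := by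
  refine ⟨(∑' j : ℤ, 1 / ((j : ℝ) * Real.pi) ^ 2) + 1, ?_, fun k => ?_⟩
  · have : 0 ≤ ∑' j : ℤ, 1 / ((j : ℝ) * Real.pi) ^ 2 := tsum_nonneg fun j => by positivity
    linarith
  · have hk : (k : ℝ) + 1 / 2 ≠ 0 := by
      intro h
      have h2 : (2 * k + 1 : ℝ) = 0 := by linarith
      norm_cast at h2
      omega
    refine (norm_tsum_resolvent_add_le (mul_ne_zero hk Real.pi_ne_zero)).trans ?_
    gcongr
    linarith
end

section
/- With μ_k := (k+1/2)π, s_k the principal square root of −i·μ_k, and φ_k(x) = ( e^{−2 s_k}·e^{s_k x} + e^{−s_k x} ) / ( s_k·( e^{−2 s_k} − 1 ) ), the L²-norms tend to zero: ∫₀¹ |φ_k(x)|² dx → 0 as |k| → ∞. -/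
/-- `μ k = (k + 1/2)π`. -/
noncomputable def mu (k : ℤ) : ℝ := ((k : ℝ) + 1/2) * Real.pi

/-- `s k` is the principal square root of `−i μ_k`. -/
noncomputable def sqk (k : ℤ) : ℂ := (-Complex.I * (mu k : ℂ)) ^ ((1:ℂ)/2)

/-- `φ_k(x) = (e^{−2 s_k} e^{s_k x} + e^{−s_k x}) / (s_k (e^{−2 s_k} − 1))`. -/
noncomputable def phik (k : ℤ) (x : ℝ) : ℂ :=
  (Complex.exp (-2 * sqk k) * Complex.exp (sqk k * (x : ℂ))
      + Complex.exp (-(sqk k) * (x : ℂ))) /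
    (sqk k * (Complex.exp (-2 * sqk k) - 1))

theorem sqk_re (k : ℤ) : (sqk k).re = √(|mu k| / 2) := by
  rw [sqk, one_div, Complex.cpow_inv_two_re]
  simp

theorem tendsto_abs_mu : Filter.Tendsto (fun k : ℤ => |mu k|) Filter.cofinite Filter.atTop := by
  have h : Filter.Tendsto (fun k : ℤ => |(k : ℝ)| - 1 / 2) Filter.cofinite Filter.atTop :=
    Filter.tendsto_atTop_add_const_right _ _
      ((tendsto_norm_cocompact_atTop (E := ℝ)).comp Int.tendsto_coe_cofinite)
  refine Filter.tendsto_atTop_mono (fun k => ?_) h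
  have h1 : |(k : ℝ)| - 1 / 2 ≤ |(k : ℝ) + 1 / 2| := by
    have := abs_sub_abs_le_abs_sub (k : ℝ) (-(1 / 2))
    rw [abs_neg, abs_of_pos (by norm_num : (0 : ℝ) < 1 / 2), sub_neg_eq_add] at this
    exact this
  rw [mu, abs_mul, abs_of_pos Real.pi_pos]
  nlinarith [abs_nonneg ((k : ℝ) + 1 / 2), Real.pi_gt_three]

theorem norm_phik_le {k : ℤ} (hk : 1 ≤ (sqk k).re) {x : ℝ} (hx₀ : 0 ≤ x) (hx₁ : x ≤ 1) :
    ‖phik k x‖ ≤ 4 / (sqk k).re := by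
  have hnum : ‖Complex.exp (-2 * sqk k) * Complex.exp (sqk k * (x : ℂ))
      + Complex.exp (-(sqk k) * (x : ℂ))‖ ≤ 2 := by
    rw [← Complex.exp_add]
    refine (norm_add_le _ _).trans ?_
    rw [Complex.norm_exp, Complex.norm_exp]
    have h₁ : Real.exp (-2 * sqk k + sqk k * (x : ℂ)).re ≤ 1 := by
      rw [Real.exp_le_one_iff]
      simp
      nlinarith
    have h₂ : Real.exp (-(sqk k) * (x : ℂ)).re ≤ 1 := by
      rw [Real.exp_le_one_iff]
      simp
      positivity
    linarith
  have hexp : ‖Complex.exp (-2 * sqk k)‖ ≤ 1 / 2 := by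
    have hre : (-2 * sqk k).re = -(2 * (sqk k).re) := by simp
    rw [Complex.norm_exp, hre, Real.exp_neg, ← one_div]
    exact one_div_le_one_div_of_le two_pos (by linarith [Real.add_one_le_exp (2 * (sqk k).re)])
  have hsub : 1 / 2 ≤ ‖Complex.exp (-2 * sqk k) - 1‖ := by
    have := norm_sub_norm_le 1 (Complex.exp (-2 * sqk k))
    rw [norm_one, norm_sub_rev] at this
    linarith
  have hden : (sqk k).re * (1 / 2) ≤ ‖sqk k * (Complex.exp (-2 * sqk k) - 1)‖ := by
    rw [norm_mul]
    exact mul_le_mul (Complex.re_le_norm _) hsub (by norm_num) (norm_nonneg _)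
  calc ‖phik k x‖ ≤ 2 / ((sqk k).re * (1 / 2)) := by
        rw [phik, norm_div]
        exact div_le_div₀ two_pos.le hnum (by positivity) hden
    _ = 4 / (sqk k).re := by
        field_simp
        norm_num

/-- `∫₀¹ |φ_k(x)|² dx → 0` as `|k| → ∞`. -/
theorem stmt_12 :
    Filter.Tendsto (fun k : ℤ => ∫ x in (0:ℝ)..1, ‖phik k x‖ ^ 2)
      Filter.cofinite (nhds 0) := by
  have hlim : Filter.Tendsto (fun k : ℤ => 32 / |mu k|) Filter.cofinite (nhds 0) :=
    tendsto_abs_mu.const_div_atTop 32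
  refine squeeze_zero_norm' ?_ hlim
  filter_upwards [tendsto_abs_mu.eventually_ge_atTop 2] with k hk
  have hre : 1 ≤ (sqk k).re := by
    rw [sqk_re, Real.one_le_sqrt]
    linarith
  have hsq : (4 / (sqk k).re) ^ 2 = 32 / |mu k| := by
    rw [div_pow, sqk_re, Real.sq_sqrt (by positivity)]
    field_simp
    norm_num
  have h := intervalIntegral.norm_integral_le_of_norm_le_const
    (a := 0) (b := 1) (f := fun x => ‖phik k x‖ ^ 2) (C := 32 / |mu k|) fun x hx => by
      rw [Set.uIoc_of_le zero_le_one] at hx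
      rw [norm_pow, norm_norm, ← hsq]
      exact pow_le_pow_left₀ (norm_nonneg _) (norm_phik_le hre hx.1.le hx.2) 2
  simpa using h
end

section
/- With μ_k := (k+1/2)π, s_k the principal square root of −i·μ_k, and φ_k(x) = ( e^{−2 s_k}·e^{s_k x} + e^{−s_k x} ) / ( s_k·( e^{−2 s_k} − 1 ) ), there exist constants 0 < c ≤ C such that for every k ∈ ℤ: c · e^{−√(π|k|/2)} / √(1+|k|) ≤ | φ_k(1) | ≤ C · e^{−√(π|k|/2)} / √(1+|k|). -/
theorem cpow_half_sq (z : ℂ) : (z ^ ((1 : ℂ) / 2)) ^ 2 = z := by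
  simp

theorem cpow_half_re_nonneg (z : ℂ) : 0 ≤ (z ^ ((1 : ℂ) / 2)).re := by
  rcases eq_or_ne z 0 with rfl | hz
  · simp
  · rw [Complex.cpow_def_of_ne_zero hz, Complex.exp_re]
    have him : (Complex.log z * (1 / 2)).im = z.arg / 2 := by
      simp [Complex.mul_im, Complex.log_im]
      ring
    rw [him]
    have h₁ := Complex.neg_pi_lt_arg z
    have h₂ := Complex.arg_le_pi z
    exact mul_nonneg (Real.exp_pos _).le
      (Real.cos_nonneg_of_neg_pi_div_two_le_of_le (by linarith) (by linarith))

theorem sqk_norm_sq (k : ℤ) : ‖sqk k‖ ^ 2 = |mu k| := by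
  rw [← norm_pow, sqk, cpow_half_sq]
  simp

theorem sqk_re_sq (k : ℤ) : (sqk k).re ^ 2 = |mu k| / 2 := by
  have hre : ((sqk k) ^ 2).re = 0 := by
    rw [sqk, cpow_half_sq]
    simp
  have hn := sqk_norm_sq k
  rw [Complex.sq_norm, Complex.normSq_apply] at hn
  rw [pow_two, Complex.mul_re] at hre
  linarith

theorem norm_phik_one (k : ℤ) :
    ‖phik k 1‖ = 2 * Real.exp (-(sqk k).re) / (‖sqk k‖ * ‖Complex.exp (-2 * sqk k) - 1‖) := by
  have h : Complex.exp (-2 * sqk k) * Complex.exp (sqk k * ((1 : ℝ) : ℂ))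
      + Complex.exp (-(sqk k) * ((1 : ℝ) : ℂ)) = 2 * Complex.exp (-(sqk k)) := by
    rw [← Complex.exp_add, Complex.ofReal_one, mul_one, mul_one,
      show -2 * sqk k + sqk k = -(sqk k) by ring]
    ring
  rw [phik, h, norm_div, norm_mul, norm_mul, Complex.norm_exp]
  simp

theorem one_half_le_abs_add_one_half (k : ℤ) : 1 / 2 ≤ |(k : ℝ) + 1 / 2| := by
  rcases le_or_gt 0 k with h | h
  · have : (0 : ℝ) ≤ k := by exact_mod_cast h
    exact le_abs.2 (Or.inl (by linarith))
  · have : (k : ℝ) ≤ -1 := by exact_mod_cast Int.le_sub_one_of_lt h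
    exact le_abs.2 (Or.inr (by linarith))

/-- Two-sided bound `|φ_k(1)| ≍ e^{−√(π|k|/2)}/√(1+|k|)`. -/
theorem stmt_13 :
    ∃ c C : ℝ, 0 < c ∧ c ≤ C ∧ ∀ k : ℤ,
      c * Real.exp (-Real.sqrt (Real.pi * |(k:ℝ)| / 2)) / Real.sqrt (1 + |(k:ℝ)|)
          ≤ ‖phik k 1‖ ∧
      ‖phik k 1‖
          ≤ C * Real.exp (-Real.sqrt (Real.pi * |(k:ℝ)| / 2)) / Real.sqrt (1 + |(k:ℝ)|) := by
  refine ⟨Real.exp (-1) / 2, 8 * Real.exp 1, by positivity, ?_, fun k => ?_⟩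
  · have h : Real.exp (-1) ≤ Real.exp 1 := Real.exp_le_exp.2 (by norm_num)
    linarith [Real.exp_pos 1]
  have hm := one_half_le_abs_add_one_half k
  have hmk : |(k : ℝ) + 1 / 2| ≤ |(k : ℝ)| + 1 / 2 := by
    simpa using abs_add_le (k : ℝ) (1 / 2)
  have hkm : |(k : ℝ)| ≤ |(k : ℝ) + 1 / 2| + 1 / 2 := by
    have := abs_sub ((k : ℝ) + 1 / 2) (1 / 2)
    rw [add_sub_cancel_right, abs_of_pos (by norm_num : (0 : ℝ) < 1 / 2)] at this
    exact this
  have hmu : |mu k| = |(k : ℝ) + 1 / 2| * Real.pi := by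
    rw [mu, abs_mul, abs_of_pos Real.pi_pos]
  have hn := sqk_norm_sq k
  have hr := sqk_re_sq k
  have ha : 0 ≤ (sqk k).re := cpow_half_re_nonneg _
  rw [hmu] at hn hr
  rw [norm_phik_one]
  have hb := Real.sqrt_nonneg (Real.pi * |(k : ℝ)| / 2)
  have hb2 := Real.sq_sqrt (by positivity : 0 ≤ Real.pi * |(k : ℝ)| / 2)
  have hq : 0 < Real.sqrt (1 + |(k : ℝ)|) := Real.sqrt_pos.2 (by positivity)
  have hq2 := Real.sq_sqrt (by positivity : 0 ≤ 1 + |(k : ℝ)|)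
  have hs := norm_nonneg (sqk k)
  have hre : ‖Complex.exp (-2 * sqk k)‖ = Real.exp (-2 * (sqk k).re) := by
    rw [Complex.norm_exp]
    simp
  have hπ := Real.pi_gt_three
  have hπ4 := Real.pi_le_four
  set a := (sqk k).re
  set b := Real.sqrt (Real.pi * |(k : ℝ)| / 2)
  set q := Real.sqrt (1 + |(k : ℝ)|)
  set m := |(k : ℝ) + 1 / 2|
  set n := |(k : ℝ)|
  have hab : a ≤ b + 1 := abs_le_of_sq_le_sq' (by nlinarith) (by linarith) |>.2
  have hba : b ≤ a + 1 := abs_le_of_sq_le_sq' (by nlinarith) (by linarith) |>.2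
  have ha2 : 1 / 2 ≤ a := abs_le_of_sq_le_sq' (by nlinarith) ha |>.2
  have hsq : ‖sqk k‖ ≤ 2 * q := abs_le_of_sq_le_sq' (by nlinarith) (by linarith) |>.2
  have hqs : q / 2 ≤ ‖sqk k‖ := abs_le_of_sq_le_sq' (by nlinarith) hs |>.2
  have hexp : Real.exp (-2 * a) ≤ 1 / 2 := by
    have h₁ : Real.exp (-2 * a) ≤ Real.exp (-1) := Real.exp_le_exp.2 (by linarith)
    linarith [Real.exp_neg_one_lt_half]
  have hd₁ : 1 / 2 ≤ ‖Complex.exp (-2 * sqk k) - 1‖ := by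
    have := norm_sub_norm_le (1 : ℂ) (Complex.exp (-2 * sqk k))
    rw [norm_one, norm_sub_rev, hre] at this
    linarith
  have hd₂ : ‖Complex.exp (-2 * sqk k) - 1‖ ≤ 2 := by
    have := norm_sub_le (Complex.exp (-2 * sqk k)) 1
    rw [norm_one, hre] at this
    linarith
  constructor
  · calc Real.exp (-1) / 2 * Real.exp (-b) / q = 2 * Real.exp (-(b + 1)) / (2 * q * 2) := by
          rw [neg_add, Real.exp_add]
          field_simp
      _ ≤ 2 * Real.exp (-a) / (‖sqk k‖ * ‖Complex.exp (-2 * sqk k) - 1‖) := by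
          have : 0 < ‖sqk k‖ := by linarith
          gcongr
  · calc 2 * Real.exp (-a) / (‖sqk k‖ * ‖Complex.exp (-2 * sqk k) - 1‖)
          ≤ 2 * Real.exp (1 + -b) / (q / 2 * (1 / 2)) := by
          gcongr
          linarith
      _ = 8 * Real.exp 1 * Real.exp (-b) / q := by
          rw [Real.exp_add]
          field_simp
          norm_num
end

section
/- Let Z and W be separable complex Hilbert spaces. Call a family (h_n)_{n∈ℕ} in a Hilbert space H a Riesz basis if there exist an orthonormal (Hilbert) basis (u_n)_{n∈ℕ} of H and a continuous linear equivalence T : H → H with T u_n = h_n for all n. Let (z_j)_{j∈ℕ} be a Riesz basis of Z, (w_k)_{k∈ℕ} a Riesz basis of W, and (v_j)_{j∈ℕ} a sequence in W with ∑_{j∈ℕ} ‖v_j‖_W² < ∞. Then the family in Z × W consisting of the vectors (z_j, v_j) for j ∈ ℕ together with the vectors (0, w_k) for k ∈ ℕ is a Riesz basis of Z × W (with the Hilbertian product norm). -/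
/-- A quadratically summable family is the image of a Hilbert basis under a bounded operator. -/
theorem HilbertBasis.exists_continuousLinearMap_apply_eq {𝕜 ι E F : Type*} [RCLike 𝕜]
    [NormedAddCommGroup E] [InnerProductSpace 𝕜 E]
    [NormedAddCommGroup F] [NormedSpace 𝕜 F] [CompleteSpace F]
    (b : HilbertBasis ι 𝕜 E) (v : ι → F) (hv : Summable fun i => ‖v i‖ ^ 2) :
    ∃ f : E →L[𝕜] F, ∀ i, f (b i) = v i := by
  classical
  have holder : ∀ x, (Summable fun i => ‖b.repr x i‖ * ‖v i‖) ∧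
      ∑' i, ‖b.repr x i‖ * ‖v i‖ ≤ √(∑' i, ‖v i‖ ^ 2) * ‖x‖ := by
    intro x
    have hx : Summable fun i => ‖b.repr x i‖ ^ (2 : ℝ) := by
      simpa [b.repr_apply_apply] using b.orthonormal.inner_products_summable x
    have hx_le : ∑' i, ‖b.repr x i‖ ^ 2 ≤ ‖x‖ ^ 2 := by
      simpa [b.repr_apply_apply] using b.orthonormal.tsum_inner_products_le x
    obtain ⟨hs, hle⟩ := Real.summable_and_inner_le_Lp_mul_Lq_tsum_of_nonneg
      Real.HolderConjugate.two_two (fun i => norm_nonneg (b.repr x i))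
      (fun i => norm_nonneg (v i)) hx (by simpa using hv)
    refine ⟨hs, hle.trans ?_⟩
    simp only [Real.rpow_two, ← Real.sqrt_eq_rpow]
    rw [mul_comm]
    gcongr
    exact Real.sqrt_le_iff.2 ⟨norm_nonneg x, hx_le⟩
  have hsum : ∀ x, Summable fun i => b.repr x i • v i := fun x =>
    Summable.of_norm (by simpa [norm_smul] using (holder x).1)
  let L : E →ₗ[𝕜] F :=
    { toFun := fun x => ∑' i, b.repr x i • v i
      map_add' := fun x y => by
        rw [← (hsum x).tsum_add (hsum y)]
        simp [add_smul]
      map_smul' := fun c x => by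
        simp [← (hsum x).tsum_const_smul, mul_smul] }
  refine ⟨L.mkContinuous (√(∑' i, ‖v i‖ ^ 2)) fun x => ?_, fun i => ?_⟩
  · refine (norm_tsum_le_tsum_norm ?_).trans ?_
    · simpa [norm_smul] using (holder x).1
    · simpa [norm_smul] using (holder x).2
  · change ∑' j, b.repr (b i) j • v j = v i
    rw [tsum_eq_single i fun j hj => by simp [b.repr_self, hj]]
    simp [b.repr_self]

/-- Two Hilbert bases combine into a Hilbert basis of the Hilbertian product. -/
theorem HilbertBasis.exists_prod {𝕜 ι κ E F : Type*} [RCLike 𝕜]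
    [NormedAddCommGroup E] [InnerProductSpace 𝕜 E] [CompleteSpace E]
    [NormedAddCommGroup F] [InnerProductSpace 𝕜 F] [CompleteSpace F]
    (b : HilbertBasis ι 𝕜 E) (c : HilbertBasis κ 𝕜 F) :
    ∃ d : HilbertBasis (ι ⊕ κ) 𝕜 (WithLp 2 (E × F)),
      (∀ i, d (Sum.inl i) = WithLp.toLp 2 (b i, 0)) ∧
        ∀ k, d (Sum.inr k) = WithLp.toLp 2 (0, c k) := by
  classical
  let e : ι ⊕ κ → WithLp 2 (E × F) :=
    Sum.elim (fun i => WithLp.toLp 2 (b i, 0)) fun k => WithLp.toLp 2 (0, c k)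
  have he : Orthonormal 𝕜 e := by
    rw [orthonormal_iff_ite]
    rintro (i | k) (j | l) <;>
      simp [e, WithLp.prod_inner_apply, orthonormal_iff_ite.1 b.orthonormal,
        orthonormal_iff_ite.1 c.orthonormal]
  have hspan : (Submodule.span 𝕜 (Set.range e))ᗮ = ⊥ := by
    rw [Submodule.eq_bot_iff]
    intro x hx
    have hx' : ∀ i, inner 𝕜 (e i) x = 0 := fun i =>
      hx _ (Submodule.subset_span ⟨i, rfl⟩)
    have h₁ : x.fst = 0 := b.repr.map_eq_zero_iff.1 <| by
      ext i
      simpa [e, WithLp.prod_inner_apply, b.repr_apply_apply] using hx' (Sum.inl i)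
    have h₂ : x.snd = 0 := c.repr.map_eq_zero_iff.1 <| by
      ext k
      simpa [e, WithLp.prod_inner_apply, c.repr_apply_apply] using hx' (Sum.inr k)
    exact WithLp.ofLp_injective 2 (Prod.ext h₁ h₂)
  exact ⟨HilbertBasis.mkOfOrthogonalEqBot he hspan, by simp [e], by simp [e]⟩


/-- A family `h : ι → H` in a complex Hilbert space is a Riesz basis if it is the image
of a Hilbert (orthonormal) basis under a continuous linear equivalence of `H`. -/
def IsRieszBasis {H : Type*} [NormedAddCommGroup H] [InnerProductSpace ℂ H]
    {ι : Type*} (h : ι → H) : Prop :=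
  ∃ (u : HilbertBasis ι ℂ H) (T : H ≃L[ℂ] H), ∀ i, T (u i) = h i

/-- If `(z_j)` is a Riesz basis of `Z`, `(w_k)` a Riesz basis of `W`, and `(v_j) ⊂ W`
is quadratically summable, then the family of vectors `(z_j, v_j)` together with
`(0, w_k)` is a Riesz basis of the Hilbertian product `Z × W`. -/
theorem stmt_14 {Z W : Type*}
    [NormedAddCommGroup Z] [InnerProductSpace ℂ Z] [CompleteSpace Z]
    [TopologicalSpace.SeparableSpace Z]
    [NormedAddCommGroup W] [InnerProductSpace ℂ W] [CompleteSpace W]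
    [TopologicalSpace.SeparableSpace W]
    (z : ℕ → Z) (w : ℕ → W) (v : ℕ → W)
    (hz : IsRieszBasis z) (hw : IsRieszBasis w)
    (hv : Summable fun j => ‖v j‖ ^ 2) :
    IsRieszBasis (fun i : ℕ ⊕ ℕ =>
      (WithLp.equiv 2 (Z × W)).symm
        (Sum.elim (fun j => (z j, v j)) (fun k => ((0 : Z), w k)) i)) := by

  obtain ⟨b, S, hS⟩ := hz
  obtain ⟨c, T, hT⟩ := hw
  obtain ⟨V, hV⟩ := b.exists_continuousLinearMap_apply_eq v hv
  obtain ⟨d, hd₁, hd₂⟩ := b.exists_prod c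
  let P := WithLp.prodContinuousLinearEquiv 2 ℂ Z W
  refine ⟨d, (P.trans (S.skewProd T V)).trans P.symm, ?_⟩
  rintro (j | k)
  · simp [P, hd₁, hS, hV]
  · simp [P, hd₂, hT]
end

section
/- For every real T > 2 there exists a constant C > 0 such that for all finitely supported families of complex numbers (α_j)_{j≥0} and (β_k)_{k∈ℤ}: ∑_{j≥0} e^{−2T(jπ)²}·|α_j|² + ∑_{k∈ℤ} |β_k|² ≤ C · ∫₀^T | ∑_{j≥0} α_j·e^{−(jπ)² t} + ∑_{k∈ℤ} β_k·e^{i(k+1/2)π t} |² dt. -/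
open MeasureTheory Filter Topology Finset

/-- The exponential sum `∑_{j ∈ s} b_j e^{-λ_j t}`. -/
noncomputable def expSum (s : Finset ℕ) (lam : ℕ → ℝ) (b : ℕ → ℂ) (t : ℝ) : ℂ :=
  ∑ j ∈ s, b j * (Real.exp (-(lam j * t)) : ℂ)

/-- The Laplace transform of the uniform distribution on `[0, 1]`. -/
noncomputable def boxLaplace (x : ℝ) : ℝ := ∫ u in (0:ℝ)..1, Real.exp (-(x * u))

theorem mul_boxLaplace (x : ℝ) : x * boxLaplace x = 1 - Real.exp (-x) := by
  have h : ∀ u ∈ Set.uIcc (0:ℝ) 1,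
      HasDerivAt (fun u => -Real.exp (-(x * u))) (x * Real.exp (-(x * u))) u := by
    intro u _
    exact (((hasDerivAt_id' u).const_mul x).neg.exp).neg.congr_deriv (by simp [mul_comm])
  have := intervalIntegral.integral_eq_sub_of_hasDerivAt h
    (Continuous.intervalIntegrable (by fun_prop) _ _)
  rw [intervalIntegral.integral_const_mul] at this
  rw [boxLaplace, this]
  simp; ring

theorem boxLaplace_le_one {x : ℝ} (hx : 0 ≤ x) : boxLaplace x ≤ 1 := by
  have := intervalIntegral.integral_mono_on (μ := volume) (f := fun u => Real.exp (-(x * u)))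
    (g := fun _ => (1:ℝ)) zero_le_one
    (Continuous.intervalIntegrable (by fun_prop) _ _)
    (Continuous.intervalIntegrable (by fun_prop) _ _)
    (fun u hu => Real.exp_le_one_iff.2 (by nlinarith [hu.1]))
  simpa [boxLaplace] using this

theorem exp_neg_le_boxLaplace {x : ℝ} (hx : 0 ≤ x) : Real.exp (-x) ≤ boxLaplace x := by
  have := intervalIntegral.integral_mono_on (μ := volume) (f := fun _ => Real.exp (-x))
    (g := fun u => Real.exp (-(x * u))) zero_le_one
    (Continuous.intervalIntegrable (by fun_prop) _ _)
    (Continuous.intervalIntegrable (by fun_prop) _ _)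
    (fun u hu => Real.exp_le_exp.2 (by nlinarith [hu.2]))
  simpa [boxLaplace] using this

theorem boxLaplace_nonneg {x : ℝ} (hx : 0 ≤ x) : 0 ≤ boxLaplace x :=
  (Real.exp_pos _).le.trans (exp_neg_le_boxLaplace hx)

@[fun_prop]
theorem continuous_expSum (s : Finset ℕ) (lam : ℕ → ℝ) (b : ℕ → ℂ) :
    Continuous (expSum s lam b) := by
  unfold expSum; fun_prop

theorem expSum_boxLaplace (s : Finset ℕ) (lam : ℕ → ℝ) (b : ℕ → ℂ) (a t : ℝ) :
    expSum s lam (fun j => boxLaplace (a * lam j) * b j) t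
      = ∫ u in (0:ℝ)..1, expSum s lam b (t + a * u) := by
  unfold expSum
  rw [intervalIntegral.integral_finsetSum
    (fun j _ => Continuous.intervalIntegrable (by fun_prop) _ _)]
  refine Finset.sum_congr rfl fun j _ => ?_
  have : ∀ u : ℝ, b j * (Real.exp (-(lam j * (t + a * u))) : ℂ)
      = (b j * (Real.exp (-(lam j * t)) : ℂ)) * ((Real.exp (-(a * lam j * u)) : ℝ) : ℂ) := by
    intro u
    rw [mul_assoc, ← Complex.ofReal_mul, ← Real.exp_add]
    congr 4; ring
  simp_rw [this]
  rw [intervalIntegral.integral_const_mul, intervalIntegral.integral_ofReal, boxLaplace]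
  ring

theorem expSum_mul_boxLaplace (s : Finset ℕ) (lam : ℕ → ℝ) (b : ℕ → ℂ) {a : ℝ} (ha : a ≠ 0) (t : ℝ) :
    expSum s lam (fun j => lam j * (boxLaplace (a * lam j) * b j)) t
      = (expSum s lam b t - expSum s lam b (t + a)) / a := by
  unfold expSum
  rw [← Finset.sum_sub_distrib, Finset.sum_div]
  refine Finset.sum_congr rfl fun j _ => ?_
  have h := mul_boxLaplace (a * lam j)
  have h2 : (lam j : ℂ) * boxLaplace (a * lam j) = (1 - Real.exp (-(a * lam j)) : ℝ) / (a : ℂ) := by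
    rw [← h, eq_div_iff (Complex.ofReal_ne_zero.2 ha)]; push_cast; ring
  dsimp only
  rw [← mul_assoc, h2, show -(lam j * (t + a)) = -(lam j * t) + -(a * lam j) by ring, Real.exp_add]
  push_cast; ring

theorem norm_expSum_boxLaplace_le {s : Finset ℕ} {lam : ℕ → ℝ} {b : ℕ → ℂ} {a t M : ℝ} (ha : 0 ≤ a)
    (h : ∀ v ∈ Set.Icc t (t + a), ‖expSum s lam b v‖ ≤ M) :
    ‖expSum s lam (fun j => boxLaplace (a * lam j) * b j) t‖ ≤ M := by
  rw [expSum_boxLaplace]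
  have := intervalIntegral.norm_integral_le_of_norm_le_const (a := 0) (b := 1) (C := M)
    (f := fun u => expSum s lam b (t + a * u)) (fun u hu => by
      rw [Set.uIoc_of_le zero_le_one] at hu
      exact h _ ⟨by nlinarith [hu.1], by nlinarith [hu.2]⟩)
  simpa using this

theorem norm_expSum_boxLaplace_le_integral {s : Finset ℕ} {lam : ℕ → ℝ} {b : ℕ → ℂ} {a t L : ℝ}
    (ha : 0 < a) (ht : 0 ≤ t) (hL : t + a ≤ L) :
    ‖expSum s lam (fun j => boxLaplace (a * lam j) * b j) t‖
      ≤ 1 / a * ∫ v in (0:ℝ)..L, ‖expSum s lam b v‖ := by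
  rw [expSum_boxLaplace]
  have h1 := intervalIntegral.norm_integral_le_integral_norm (μ := volume) (a := 0) (b := 1)
    (f := fun u => expSum s lam b (t + a * u)) zero_le_one
  have h2 := intervalIntegral.integral_comp_add_mul (a := 0) (b := 1)
    (fun v => ‖expSum s lam b v‖) ha.ne' t
  rw [h2, smul_eq_mul, mul_zero, mul_one, add_zero, ← one_div] at h1
  refine h1.trans (mul_le_mul_of_nonneg_left ?_ (by positivity))
  exact intervalIntegral.integral_mono_interval ht (by linarith) hL
    (Eventually.of_forall fun _ => norm_nonneg _) (Continuous.intervalIntegrable (by fun_prop) _ _)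

/-- Multiplying the coefficients by `λ_j^n` and by sufficiently many box factors costs only a
constant depending on the box widths, relative to the `L¹` norm of the original sum. -/
theorem norm_expSum_prod_boxLaplace_le {s : Finset ℕ} {lam : ℕ → ℝ} {b : ℕ → ℂ} {a : ℕ → ℝ}
    (ha : ∀ m, 0 < a m) {L : ℝ} (n k : ℕ) {t : ℝ} (ht : 0 ≤ t)
    (hL : t + ∑ m ∈ range (n + 1 + k), a m ≤ L) :
    ‖expSum s lam
        (fun j => lam j ^ n * ((∏ m ∈ range (n + 1 + k), boxLaplace (a m * lam j) : ℝ) * b j)) t‖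
      ≤ 1 / a 0 * (∏ m ∈ range n, 2 / a (m + 1)) * ∫ v in (0:ℝ)..L, ‖expSum s lam b v‖ := by
  induction k generalizing t with
  | zero =>
    induction n generalizing t with
    | zero =>
      simp only [pow_zero, zero_add, add_zero, range_one, prod_singleton, one_mul, range_zero,
        prod_empty, mul_one, sum_singleton] at hL ⊢
      exact norm_expSum_boxLaplace_le_integral (ha 0) ht hL
    | succ n ih =>
      simp only [add_zero] at ih hL ⊢
      rw [sum_range_succ] at hL
      have hpos := ha (n + 1)
      set c : ℕ → ℂ := fun j => lam j ^ n *
        ((∏ m ∈ range (n + 1), boxLaplace (a m * lam j) : ℝ) * b j) with hc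
      have key : (fun j => (lam j : ℂ) ^ (n + 1) *
          ((∏ m ∈ range (n + 1 + 1), boxLaplace (a m * lam j) : ℝ) * b j))
          = fun j => lam j * (boxLaplace (a (n + 1) * lam j) * c j) := by
        funext j
        rw [hc, prod_range_succ]; push_cast; ring
      rw [key, expSum_mul_boxLaplace _ _ _ hpos.ne', norm_div, Complex.norm_real,
        Real.norm_of_nonneg hpos.le, div_le_iff₀ hpos, prod_range_succ]
      have e1 := ih ht (by linarith)
      have e2 := ih (t := t + a (n + 1)) (by linarith) (by linarith)
      refine (norm_sub_le _ _).trans ((add_le_add e1 e2).trans (le_of_eq ?_))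
      field_simp; ring
  | succ k ih =>
    rw [← add_assoc, sum_range_succ] at hL
    have key : (fun j => (lam j : ℂ) ^ n *
          ((∏ m ∈ range (n + 1 + (k + 1)), boxLaplace (a m * lam j) : ℝ) * b j))
          = fun j => boxLaplace (a (n + 1 + k) * lam j) * (lam j ^ n *
            ((∏ m ∈ range (n + 1 + k), boxLaplace (a m * lam j) : ℝ) * b j)) := by
      funext j
      rw [← add_assoc, prod_range_succ]; push_cast; ring
    rw [key]
    refine norm_expSum_boxLaplace_le (ha _).le fun v hv => ih (ht.trans hv.1) ?_
    linarith [hv.2]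

theorem exists_tendsto_prod_boxLaplace {a : ℕ → ℝ} (ha : ∀ m, 0 < a m) {L : ℝ}
    (hL : ∀ N, ∑ m ∈ range N, a m ≤ L) {x : ℝ} (hx : 0 ≤ x) :
    ∃ y, Real.exp (-(x * L)) ≤ y ∧
      Tendsto (fun N => ∏ m ∈ range N, boxLaplace (a m * x)) atTop (𝓝 y) := by
  have hax : ∀ m, 0 ≤ a m * x := fun m => mul_nonneg (ha m).le hx
  have hlow : ∀ N, Real.exp (-(x * L)) ≤ ∏ m ∈ range N, boxLaplace (a m * x) := by
    intro N
    calc Real.exp (-(x * L)) ≤ Real.exp (∑ m ∈ range N, -(a m * x)) := by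
          rw [Finset.sum_neg_distrib, ← Finset.sum_mul]
          exact Real.exp_le_exp.2 (by nlinarith [hL N])
      _ = ∏ m ∈ range N, Real.exp (-(a m * x)) := Real.exp_sum _ _
      _ ≤ _ := prod_le_prod (fun _ _ => (Real.exp_pos _).le)
          fun m _ => exp_neg_le_boxLaplace (hax m)
  have hanti : Antitone fun N => ∏ m ∈ range N, boxLaplace (a m * x) := by
    refine antitone_nat_of_succ_le fun N => ?_
    rw [prod_range_succ]
    exact mul_le_of_le_one_right (prod_nonneg fun m _ => boxLaplace_nonneg (hax m))
      (boxLaplace_le_one (hax N))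
  exact ⟨_, le_ciInf hlow, tendsto_atTop_ciInf hanti ⟨_, Set.forall_mem_range.2 hlow⟩⟩

theorem exists_summable_boxes {L : ℝ} (hL : 0 < L) :
    ∃ a : ℕ → ℝ, (∀ m, 0 < a m) ∧ (∀ N, ∑ m ∈ range N, a m ≤ L) ∧
      Summable fun n : ℕ => 1 / a 0 * (∏ m ∈ range n, 2 / a (m + 1)) / ((2 * n).factorial : ℝ) := by
  have hs : Summable fun m : ℕ => 1 / ((m + 1 : ℕ) : ℝ) ^ (3 / 2 : ℝ) :=
    (summable_nat_add_iff 1).2 (Real.summable_one_div_nat_rpow.2 (by norm_num))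
  set S := ∑' m : ℕ, 1 / ((m + 1 : ℕ) : ℝ) ^ (3 / 2 : ℝ)
  have hpos : ∀ m : ℕ, 0 < 1 / ((m + 1 : ℕ) : ℝ) ^ (3 / 2 : ℝ) := fun m => by positivity
  have hS : 0 < S := hs.tsum_pos (fun m => (hpos m).le) 0 (hpos 0)
  refine ⟨fun m => L / S * (1 / ((m + 1 : ℕ) : ℝ) ^ (3 / 2 : ℝ)), fun m => by positivity, ?_, ?_⟩
  · intro N
    rw [← mul_sum]
    have := hs.sum_le_tsum (range N) (fun m _ => (hpos m).le)
    calc _ ≤ L / S * S := by gcongr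
      _ = L := by field_simp
  · refine summable_of_ratio_test_tendsto_lt_one (l := 0) zero_lt_one ?_ ?_
    · refine Eventually.of_forall fun n => ne_of_gt ?_
      have : 0 < ∏ m ∈ range n, 2 / (L / S * (1 / ((m + 1 + 1 : ℕ) : ℝ) ^ (3 / 2 : ℝ))) :=
        prod_pos fun m _ => by positivity
      positivity
    · have hlim : Tendsto (fun n : ℕ => (2 * S / L) * ((n + 2 : ℕ) : ℝ) ^ (-(1 / 2) : ℝ) * 2)
          atTop (𝓝 0) := by
        have h0 := (tendsto_rpow_neg_atTop (y := 1 / 2) (by norm_num)).comp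
          (tendsto_natCast_atTop_atTop.comp (tendsto_add_atTop_nat 2))
        simpa using (h0.const_mul (2 * S / L)).mul_const 2
      refine squeeze_zero (fun _ => by positivity) (fun n => ?_) hlim
      have hP : 0 < ∏ m ∈ range n, 2 / (L / S * (1 / ((m + 1 + 1 : ℕ) : ℝ) ^ (3 / 2 : ℝ))) :=
        prod_pos fun m _ => by positivity
      rw [← norm_div, prod_range_succ, Real.norm_of_nonneg (by positivity)]
      set P := ∏ m ∈ range n, 2 / (L / S * (1 / ((m + 1 + 1 : ℕ) : ℝ) ^ (3 / 2 : ℝ)))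
      have hf : ((2 * (n + 1)).factorial : ℝ) = (2 * n + 2) * (2 * n + 1) * (2 * n).factorial := by
        rw [show 2 * (n + 1) = 2 * n + 1 + 1 by ring, Nat.factorial_succ, Nat.factorial_succ]
        push_cast; ring
      rw [hf]
      have hr : ((n + 2 : ℕ) : ℝ) ^ (3 / 2 : ℝ)
          = ((n + 2 : ℕ) : ℝ) ^ (-(1 / 2) : ℝ) * ((n : ℝ) + 2) ^ 2 := by
        have : ((n : ℝ) + 2) ^ 2 = ((n + 2 : ℕ) : ℝ) ^ (2 : ℝ) := by
          rw [Real.rpow_two]; push_cast; ring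
        rw [this, ← Real.rpow_add (by positivity)]; norm_num
      have hr0 : 0 < ((n + 2 : ℕ) : ℝ) ^ (-(1 / 2) : ℝ) := by positivity
      dsimp only
      rw [show n + 1 + 1 = n + 2 from rfl, hr]
      set R := ((n + 2 : ℕ) : ℝ) ^ (-(1 / 2) : ℝ)
      have hfac : (0:ℝ) < (2 * n).factorial := by positivity
      set F : ℝ := ((2 * n).factorial : ℝ)
      set A := 1 / (L / S * (1 / ((0 + 1 : ℕ) : ℝ) ^ (3 / 2 : ℝ)))
      have hA : 0 < A := by positivity
      have hn : (0:ℝ) ≤ n := by positivity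
      have : A * (P * (2 / (L / S * (1 / (R * ((n:ℝ) + 2) ^ 2)))))
            / ((2 * n + 2) * (2 * n + 1) * F) / (A * P / F)
          = (2 * S / L) * R * (((n:ℝ) + 2) ^ 2 / ((2 * n + 2) * (2 * n + 1))) := by
        field_simp
      rw [this]
      gcongr
      rw [div_le_iff₀ (by positivity)]
      nlinarith

theorem integral_cos_nat_mul_pi (n : ℕ) (hn : n ≠ 0) :
    ∫ x in (0:ℝ)..1, Real.cos (n * Real.pi * x) = 0 := by
  have h : (n * Real.pi : ℝ) ≠ 0 := by positivity
  rw [intervalIntegral.integral_comp_mul_left _ h, integral_cos]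
  simp [Real.sin_nat_mul_pi]

theorem integral_cos_mul_cos (j k : ℕ) :
    ∫ x in (0:ℝ)..1, Real.cos (j * Real.pi * x) * Real.cos (k * Real.pi * x)
      = if j = k then (if j = 0 then 1 else 1 / 2) else 0 := by
  wlog hjk : k ≤ j generalizing j k
  · have := this k j (by omega)
    simp_rw [mul_comm (Real.cos (j * Real.pi * _))]
    rw [this]
    by_cases h : j = k
    · subst h; rfl
    · simp [h, Ne.symm h]
  have h : ∀ x : ℝ, Real.cos (j * Real.pi * x) * Real.cos (k * Real.pi * x)
      = 1 / 2 * (Real.cos ((j - k : ℕ) * Real.pi * x) + Real.cos ((j + k : ℕ) * Real.pi * x)) := by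
    intro x
    rw [Nat.cast_sub hjk, Nat.cast_add, sub_mul, sub_mul, add_mul, add_mul, Real.cos_sub,
      Real.cos_add]
    ring
  simp_rw [h]
  rw [intervalIntegral.integral_const_mul, intervalIntegral.integral_add
    (Continuous.intervalIntegrable (by fun_prop) _ _)
    (Continuous.intervalIntegrable (by fun_prop) _ _)]
  by_cases e : j = k
  · subst e
    rcases eq_or_ne j 0 with rfl | hj
    · norm_num
    · rw [integral_cos_nat_mul_pi (j + j) (by omega)]
      simp [hj]
  · rw [integral_cos_nat_mul_pi _ (by omega), integral_cos_nat_mul_pi _ (by omega)]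
    simp [e]

theorem norm_coeff_le_of_norm_cos_sum_le {s : Finset ℕ} {c : ℕ → ℂ} {M : ℝ}
    (h : ∀ x ∈ Set.Icc (0:ℝ) 1, ‖∑ k ∈ s, c k * (Real.cos (k * Real.pi * x) : ℂ)‖ ≤ M)
    {j : ℕ} (hj : j ∈ s) : ‖c j‖ ≤ 2 * M := by
  have hint : ∫ x in (0:ℝ)..1, (Real.cos (j * Real.pi * x) : ℂ) *
      ∑ k ∈ s, c k * (Real.cos (k * Real.pi * x) : ℂ)
      = c j * ((if j = 0 then 1 else 1 / 2 : ℝ) : ℂ) := by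
    simp_rw [mul_sum]
    rw [intervalIntegral.integral_finsetSum
      (fun k _ => Continuous.intervalIntegrable (by fun_prop) _ _)]
    have : ∀ k ∈ s, (∫ x in (0:ℝ)..1, (Real.cos (j * Real.pi * x) : ℂ) *
        (c k * (Real.cos (k * Real.pi * x) : ℂ)))
        = if j = k then c j * ((if j = 0 then 1 else 1 / 2 : ℝ) : ℂ) else 0 := by
      intro k _
      have e : ∀ x : ℝ, (Real.cos (j * Real.pi * x) : ℂ) * (c k * (Real.cos (k * Real.pi * x) : ℂ))
          = c k * ((Real.cos (j * Real.pi * x) * Real.cos (k * Real.pi * x) : ℝ) : ℂ) := by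
        intro x; push_cast; ring
      simp_rw [e]
      rw [intervalIntegral.integral_const_mul, intervalIntegral.integral_ofReal,
        integral_cos_mul_cos]
      by_cases hjk : j = k
      · subst hjk; simp
      · simp [hjk]
    rw [sum_congr rfl this, sum_ite_eq, if_pos hj]
  have hb := intervalIntegral.norm_integral_le_of_norm_le_const (a := 0) (b := 1) (C := M)
    (f := fun x : ℝ => (Real.cos (j * Real.pi * x) : ℂ) *
      ∑ k ∈ s, c k * (Real.cos (k * Real.pi * x) : ℂ)) (fun x hx => by
      rw [Set.uIoc_of_le zero_le_one] at hx
      rw [norm_mul, Complex.norm_real]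
      exact (mul_le_of_le_one_left (norm_nonneg _) (Real.abs_cos_le_one _)).trans
        (h x ⟨hx.1.le, hx.2⟩))
  rw [hint, norm_mul, Complex.norm_real] at hb
  have : (1 / 2 : ℝ) ≤ ‖(if j = 0 then 1 else 1 / 2 : ℝ)‖ := by split_ifs <;> norm_num
  have := mul_le_mul_of_nonneg_left this (norm_nonneg (c j))
  rw [sub_zero, abs_one, mul_one] at hb
  linarith

/-- The eigenvalues `(jπ)²` of the Neumann Laplacian on the unit interval. -/
noncomputable def neumannEigenvalue (j : ℕ) : ℝ := (j * Real.pi) ^ 2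

theorem neumannEigenvalue_nonneg (j : ℕ) : 0 ≤ neumannEigenvalue j := sq_nonneg _

theorem hasSum_cos_neumannEigenvalue (j : ℕ) (x : ℝ) :
    HasSum (fun n : ℕ => (-1) ^ n * x ^ (2 * n) / (2 * n).factorial * neumannEigenvalue j ^ n)
      (Real.cos (j * Real.pi * x)) := by
  convert Real.hasSum_cos (j * Real.pi * x) using 2 with n
  rw [neumannEigenvalue, ← pow_mul, mul_pow _ x]; ring

theorem exists_norm_coeff_le_integral_expSum {ε : ℝ} (hε : 0 < ε) :
    ∃ M : ℝ, 0 < M ∧ ∀ (s : Finset ℕ) (b : ℕ → ℂ), ∀ j ∈ s,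
      ‖b j‖ ≤ M * Real.exp (ε * neumannEigenvalue j) *
        ∫ v in (0:ℝ)..ε, ‖expSum s neumannEigenvalue b v‖ := by
  obtain ⟨a, ha, haε, hsum⟩ := exists_summable_boxes hε
  choose Φ hΦ hlim using fun j =>
    exists_tendsto_prod_boxLaplace ha haε (neumannEigenvalue_nonneg j)
  set B : ℕ → ℝ := fun n => 1 / a 0 * ∏ m ∈ range n, 2 / a (m + 1) with hB
  have hB0 : ∀ n, 0 < B n := fun n =>
    mul_pos (one_div_pos.2 (ha 0)) (prod_pos fun m _ => div_pos two_pos (ha _))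
  refine ⟨2 * ∑' n, B n / (2 * n).factorial,
    mul_pos two_pos (hsum.tsum_pos (fun n => (div_pos (hB0 n) (by positivity)).le) 0
      (div_pos (hB0 0) (by positivity))), fun s b j hj => ?_⟩
  set I := ∫ v in (0:ℝ)..ε, ‖expSum s neumannEigenvalue b v‖
  have hmoment : ∀ n, ‖∑ k ∈ s, (neumannEigenvalue k : ℂ) ^ n * (Φ k * b k)‖ ≤ B n * I := by
    intro n
    have ht : Tendsto (fun N => ∑ k ∈ s, (neumannEigenvalue k : ℂ) ^ n *
        ((∏ m ∈ range (n + 1 + N), boxLaplace (a m * neumannEigenvalue k) : ℝ) * b k)) atTop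
        (𝓝 (∑ k ∈ s, (neumannEigenvalue k : ℂ) ^ n * (Φ k * b k))) := by
      refine tendsto_finsetSum _ fun k _ => ((Tendsto.mul_const _ ?_).const_mul _)
      refine (Complex.continuous_ofReal.tendsto _).comp ((hlim k).comp ?_)
      exact (tendsto_add_atTop_nat (n + 1)).congr fun N => add_comm _ _
    refine le_of_tendsto ht.norm (Eventually.of_forall fun N => ?_)
    refine le_of_eq_of_le ?_ (norm_expSum_prod_boxLaplace_le (s := s) (lam := neumannEigenvalue)
      (b := b) ha n N le_rfl ((zero_add _).trans_le (haε _)))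
    simp [expSum]
  have hcos : ∀ x ∈ Set.Icc (0:ℝ) 1,
      ‖∑ k ∈ s, (Φ k * b k) * (Real.cos (k * Real.pi * x) : ℂ)‖
        ≤ (∑' n, B n / (2 * n).factorial) * I := by
    intro x hx
    have h1 : HasSum (fun n : ℕ => ∑ k ∈ s, (Φ k * b k) * (((-1) ^ n * x ^ (2 * n) /
        (2 * n).factorial * neumannEigenvalue k ^ n : ℝ) : ℂ))
        (∑ k ∈ s, (Φ k * b k) * (Real.cos (k * Real.pi * x) : ℂ)) :=
      hasSum_sum fun k _ =>
        (Complex.hasSum_ofReal.2 (hasSum_cos_neumannEigenvalue k x)).mul_left _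
    rw [← h1.tsum_eq]
    refine tsum_of_norm_bounded (hsum.hasSum.mul_right I) fun n => ?_
    have e : ∑ k ∈ s, (Φ k * b k) * (((-1) ^ n * x ^ (2 * n) /
        (2 * n).factorial * neumannEigenvalue k ^ n : ℝ) : ℂ)
        = (((-1) ^ n * x ^ (2 * n) / (2 * n).factorial : ℝ) : ℂ) *
          ∑ k ∈ s, (neumannEigenvalue k : ℂ) ^ n * (Φ k * b k) := by
      rw [mul_sum]
      refine sum_congr rfl fun k _ => ?_
      push_cast; ring
    rw [e, norm_mul, Complex.norm_real, norm_div, norm_mul, norm_pow, norm_neg, norm_one, one_pow,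
      one_mul, Real.norm_of_nonneg (pow_nonneg hx.1 _), Real.norm_of_nonneg (Nat.cast_nonneg _)]
    calc x ^ (2 * n) / (2 * n).factorial *
          ‖∑ k ∈ s, (neumannEigenvalue k : ℂ) ^ n * (Φ k * b k)‖
        ≤ 1 / (2 * n).factorial * (B n * I) := by
          gcongr
          · exact pow_le_one₀ hx.1 hx.2
          · exact hmoment n
      _ = B n / (2 * n).factorial * I := by ring
  have hj' := norm_coeff_le_of_norm_cos_sum_le hcos hj
  rw [norm_mul, Complex.norm_real] at hj'
  have hΦj : Real.exp (-(neumannEigenvalue j * ε)) * ‖b j‖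
      ≤ 2 * ((∑' n, B n / (2 * n).factorial) * I) :=
    (mul_le_mul_of_nonneg_right ((hΦ j).trans (Real.le_norm_self _)) (norm_nonneg _)).trans hj'
  calc ‖b j‖ = Real.exp (ε * neumannEigenvalue j) *
        (Real.exp (-(neumannEigenvalue j * ε)) * ‖b j‖) := by
        rw [← mul_assoc, ← Real.exp_add]; ring_nf; simp
    _ ≤ Real.exp (ε * neumannEigenvalue j) * (2 * ((∑' n, B n / (2 * n).factorial) * I)) := by
        gcongr
    _ = _ := by ring

theorem summable_exp_neg_mul_neumannEigenvalue {c : ℝ} (hc : 0 < c) :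
    Summable fun j : ℕ => Real.exp (-c * neumannEigenvalue j) := by
  refine Summable.of_nonneg_of_le (fun _ => (Real.exp_pos _).le) (fun j => ?_)
    (Real.summable_exp_nat_mul_iff.2 (neg_lt_zero.2 hc))
  refine Real.exp_le_exp.2 ?_
  have h1 : (j : ℝ) ≤ (j : ℝ) ^ 2 := by exact_mod_cast Nat.le_self_pow two_ne_zero j
  have h2 : (j : ℝ) ≤ neumannEigenvalue j := by
    rw [neumannEigenvalue, mul_pow]
    have h3 : 1 ≤ Real.pi ^ 2 := by nlinarith [Real.pi_gt_three]
    exact h1.trans (le_mul_of_one_le_right (sq_nonneg _) h3)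
  nlinarith

/-- The finite wave sum `∑_{k ∈ s} β_k e^{i(k+1/2)πt}`. -/
noncomputable def waveSum (s : Finset ℤ) (β : ℤ → ℂ) (t : ℝ) : ℂ :=
  ∑ k ∈ s, β k * Complex.exp (Complex.I * ((((k:ℝ) + 1/2) * Real.pi * t : ℝ) : ℂ))

@[fun_prop]
theorem continuous_waveSum (s : Finset ℤ) (β : ℤ → ℂ) : Continuous (waveSum s β) := by
  unfold waveSum; fun_prop

theorem waveSum_add_two (s : Finset ℤ) (β : ℤ → ℂ) (t : ℝ) :
    waveSum s β (t + 2) = -waveSum s β t := by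
  unfold waveSum
  rw [← sum_neg_distrib]
  refine sum_congr rfl fun k _ => ?_
  have : Complex.I * ((((k:ℝ) + 1/2) * Real.pi * (t + 2) : ℝ) : ℂ)
      = Complex.I * ((((k:ℝ) + 1/2) * Real.pi * t : ℝ) : ℂ) + (k * (2 * Real.pi * Complex.I)
        + Real.pi * Complex.I) := by push_cast; ring
  rw [this, Complex.exp_add, Complex.exp_add, Complex.exp_int_mul_two_pi_mul_I, Complex.exp_pi_mul_I]
  ring

theorem integral_exp_int_mul_pi (n : ℤ) (τ : ℝ) :
    ∫ t in τ..(τ + 2), Complex.exp (n * Real.pi * Complex.I * (t : ℂ)) = if n = 0 then 2 else 0 := by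
  split_ifs with hn
  · subst hn; simp
  · have hc : (n * Real.pi * Complex.I : ℂ) ≠ 0 := by
      simp [hn, Real.pi_ne_zero]
    rw [integral_exp_mul_complex hc]
    have : (n * Real.pi * Complex.I : ℂ) * ((τ + 2 : ℝ) : ℂ)
        = n * Real.pi * Complex.I * τ + n * (2 * Real.pi * Complex.I) := by push_cast; ring
    rw [this, Complex.exp_add, Complex.exp_int_mul_two_pi_mul_I]
    simp

theorem integral_norm_sq_waveSum (s : Finset ℤ) (β : ℤ → ℂ) (τ : ℝ) :
    ∫ t in τ..(τ + 2), ‖waveSum s β t‖ ^ 2 = 2 * ∑ k ∈ s, ‖β k‖ ^ 2 := by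
  have hpt : ∀ t : ℝ, ((‖waveSum s β t‖ ^ 2 : ℝ) : ℂ) = ∑ k ∈ s, ∑ l ∈ s,
      (β k * (starRingEnd ℂ) (β l)) * Complex.exp ((k - l : ℤ) * Real.pi * Complex.I * (t : ℂ)) := by
    intro t
    push_cast
    rw [← Complex.mul_conj', waveSum, map_sum, sum_mul_sum]
    refine sum_congr rfl fun k _ => sum_congr rfl fun l _ => ?_
    rw [map_mul, ← Complex.exp_conj, map_mul, Complex.conj_I, Complex.conj_ofReal, mul_mul_mul_comm,
      ← Complex.exp_add]
    congr 2
    push_cast; ring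
  have hC : ((∫ t in τ..(τ + 2), ‖waveSum s β t‖ ^ 2 : ℝ) : ℂ)
      = ((2 * ∑ k ∈ s, ‖β k‖ ^ 2 : ℝ) : ℂ) := by
    rw [← intervalIntegral.integral_ofReal]
    simp_rw [hpt]
    rw [intervalIntegral.integral_finsetSum
      (fun k _ => Continuous.intervalIntegrable (by fun_prop) _ _), Complex.ofReal_mul,
      Complex.ofReal_sum, mul_sum]
    refine sum_congr rfl fun k hk => ?_
    rw [intervalIntegral.integral_finsetSum
      (fun l _ => Continuous.intervalIntegrable (by fun_prop) _ _)]
    simp_rw [intervalIntegral.integral_const_mul, integral_exp_int_mul_pi, sub_eq_zero, mul_ite,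
      mul_zero]
    rw [sum_ite_eq, if_pos hk, Complex.mul_conj']
    push_cast; ring
  exact_mod_cast hC

theorem sq_integral_norm_le {f : ℝ → ℂ} (hf : Continuous f) {T : ℝ} (hT : 0 < T) :
    (∫ t in (0:ℝ)..T, ‖f t‖) ^ 2 ≤ T * ∫ t in (0:ℝ)..T, ‖f t‖ ^ 2 := by
  set m := ∫ t in (0:ℝ)..T, ‖f t‖ with hm
  have h0 : 0 ≤ ∫ t in (0:ℝ)..T, (T * ‖f t‖ - m) ^ 2 :=
    intervalIntegral.integral_nonneg hT.le fun _ _ => sq_nonneg _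
  have e : ∀ t, (T * ‖f t‖ - m) ^ 2 = T ^ 2 * ‖f t‖ ^ 2 - 2 * T * m * ‖f t‖ + m ^ 2 := fun t => by
    ring
  simp_rw [e] at h0
  rw [intervalIntegral.integral_add (Continuous.intervalIntegrable (by fun_prop) _ _)
    (Continuous.intervalIntegrable (by fun_prop) _ _),
    intervalIntegral.integral_sub (Continuous.intervalIntegrable (by fun_prop) _ _)
    (Continuous.intervalIntegrable (by fun_prop) _ _), intervalIntegral.integral_const_mul,
    intervalIntegral.integral_const_mul, ← hm, intervalIntegral.integral_const, smul_eq_mul] at h0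
  have : 0 ≤ T * (T * (∫ t in (0:ℝ)..T, ‖f t‖ ^ 2) - m ^ 2) := by nlinarith
  linarith [nonneg_of_mul_nonneg_right this hT]

/-- Adding the translate by `2` kills the wave part, so the heat coefficients are controlled by
the `L²` norm of the mixed sum. -/
theorem exists_norm_coeff_le_integral_mixed {T ε : ℝ} (hε : 0 < ε) (hT : 2 + ε ≤ T) :
    ∃ M : ℝ, 0 < M ∧ ∀ (s : Finset ℕ) (α : ℕ → ℂ) (s' : Finset ℤ) (β : ℤ → ℂ), ∀ j ∈ s,
      ‖α j‖ ≤ M * Real.exp (ε * neumannEigenvalue j) *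
        √(∫ t in (0:ℝ)..T, ‖expSum s neumannEigenvalue α t + waveSum s' β t‖ ^ 2) := by
  obtain ⟨M, hM, h⟩ := exists_norm_coeff_le_integral_expSum hε
  have hT0 : 0 < T := by linarith
  refine ⟨M * (2 * √T), by positivity, fun s α s' β j hj => ?_⟩
  set f : ℝ → ℂ := fun t => expSum s neumannEigenvalue α t + waveSum s' β t with hf
  have hfc : Continuous f := by fun_prop
  set b : ℕ → ℂ := fun k => α k * ((1 + Real.exp (-(neumannEigenvalue k * 2)) : ℝ) : ℂ) with hb
  have hsum : ∀ t, expSum s neumannEigenvalue b t = f t + f (t + 2) := by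
    intro t
    have : expSum s neumannEigenvalue b t
        = expSum s neumannEigenvalue α t + expSum s neumannEigenvalue α (t + 2) := by
      simp only [expSum, ← sum_add_distrib, hb]
      refine sum_congr rfl fun k _ => ?_
      rw [mul_add (neumannEigenvalue k), neg_add, Real.exp_add]
      push_cast; ring
    rw [this, hf]
    simp only [waveSum_add_two]
    ring
  have hαb : ‖α j‖ ≤ ‖b j‖ := by
    rw [hb, norm_mul, Complex.norm_real]
    refine le_mul_of_one_le_right (norm_nonneg _) ((?_ : (1:ℝ) ≤ _).trans (Real.le_norm_self _))
    linarith [Real.exp_pos (-(neumannEigenvalue j * 2))]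
  have hnn : 0 ≤ᵐ[volume.restrict (Set.Ioc 0 T)] fun t => ‖f t‖ :=
    Eventually.of_forall fun _ => norm_nonneg _
  have hint : IntervalIntegrable (fun t => ‖f t‖) volume 0 T :=
    Continuous.intervalIntegrable (by fun_prop) _ _
  have hI : ∫ v in (0:ℝ)..ε, ‖expSum s neumannEigenvalue b v‖ ≤ 2 * ∫ t in (0:ℝ)..T, ‖f t‖ := by
    simp_rw [hsum]
    calc ∫ v in (0:ℝ)..ε, ‖f v + f (v + 2)‖
        ≤ ∫ v in (0:ℝ)..ε, (‖f v‖ + ‖f (v + 2)‖) :=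
          intervalIntegral.integral_mono_on hε.le (Continuous.intervalIntegrable (by fun_prop) _ _)
            (Continuous.intervalIntegrable (by fun_prop) _ _) fun _ _ => norm_add_le _ _
      _ = (∫ v in (0:ℝ)..ε, ‖f v‖) + ∫ v in (0 + 2 : ℝ)..(ε + 2), ‖f v‖ := by
          rw [intervalIntegral.integral_add (Continuous.intervalIntegrable (by fun_prop) _ _)
            (Continuous.intervalIntegrable (by fun_prop) _ _),
            intervalIntegral.integral_comp_add_right (fun v => ‖f v‖)]
      _ ≤ (∫ t in (0:ℝ)..T, ‖f t‖) + ∫ t in (0:ℝ)..T, ‖f t‖ := by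
          gcongr
          · exact intervalIntegral.integral_mono_interval le_rfl hε.le (by linarith) hnn hint
          · exact intervalIntegral.integral_mono_interval (by norm_num) (by linarith)
              (by linarith) hnn hint
      _ = _ := by ring
  have hL : ∫ t in (0:ℝ)..T, ‖f t‖ ≤ √T * √(∫ t in (0:ℝ)..T, ‖f t‖ ^ 2) := by
    rw [← Real.sqrt_mul hT0.le]
    exact Real.le_sqrt_of_sq_le (sq_integral_norm_le hfc hT0)
  calc ‖α j‖ ≤ _ := hαb.trans (h s b j hj)
    _ ≤ M * Real.exp (ε * neumannEigenvalue j) *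
        (2 * (√T * √(∫ t in (0:ℝ)..T, ‖f t‖ ^ 2))) := by
      gcongr; linarith
    _ = _ := by ring

theorem sum_exp_mul_norm_sq_le {s : Finset ℕ} {α : ℕ → ℂ} {T ε K : ℝ} (hεT : ε < T)
    (h : ∀ j ∈ s, ‖α j‖ ≤ K * Real.exp (ε * neumannEigenvalue j)) :
    ∑ j ∈ s, Real.exp (-2 * T * neumannEigenvalue j) * ‖α j‖ ^ 2
      ≤ K ^ 2 * ∑' j, Real.exp (-(2 * (T - ε)) * neumannEigenvalue j) := by
  calc _ ≤ ∑ j ∈ s, K ^ 2 * Real.exp (-(2 * (T - ε)) * neumannEigenvalue j) := by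
        refine sum_le_sum fun j hj => ?_
        calc _ ≤ Real.exp (-2 * T * neumannEigenvalue j) *
              (K * Real.exp (ε * neumannEigenvalue j)) ^ 2 := by
              gcongr; exact h j hj
          _ = _ := by
              rw [mul_pow, ← Real.exp_nat_mul, mul_left_comm, ← Real.exp_add]
              congr 2; push_cast; ring
    _ ≤ _ := by
        rw [← mul_sum]
        gcongr
        exact (summable_exp_neg_mul_neumannEigenvalue (by linarith)).sum_le_tsum _
          fun _ _ => (Real.exp_pos _).le

theorem norm_expSum_neumannEigenvalue_le {s : Finset ℕ} {α : ℕ → ℂ} {τ ε K t : ℝ} (hK : 0 ≤ K)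
    (hετ : ε < τ) (ht : τ ≤ t) (h : ∀ j ∈ s, ‖α j‖ ≤ K * Real.exp (ε * neumannEigenvalue j)) :
    ‖expSum s neumannEigenvalue α t‖ ≤ K * ∑' j, Real.exp (-(τ - ε) * neumannEigenvalue j) := by
  calc _ ≤ ∑ j ∈ s, K * Real.exp (-(τ - ε) * neumannEigenvalue j) := by
        refine norm_sum_le_of_le _ fun j hj => ?_
        rw [norm_mul, Complex.norm_real, Real.norm_of_nonneg (Real.exp_pos _).le]
        calc _ ≤ K * Real.exp (ε * neumannEigenvalue j) * Real.exp (-(neumannEigenvalue j * t)) := by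
              gcongr; exact h j hj
          _ ≤ _ := by
              rw [mul_assoc, ← Real.exp_add]
              gcongr
              nlinarith [neumannEigenvalue_nonneg j]
    _ ≤ _ := by
        rw [← mul_sum]
        gcongr
        exact (summable_exp_neg_mul_neumannEigenvalue (by linarith)).sum_le_tsum _
          fun _ _ => (Real.exp_pos _).le

theorem sum_norm_sq_wave_le {s : Finset ℕ} {α : ℕ → ℂ} {s' : Finset ℤ} {β : ℤ → ℂ} {T H : ℝ}
    (hT : 2 < T) (hH : ∀ t ∈ Set.Icc (T - 2) T, ‖expSum s neumannEigenvalue α t‖ ≤ H) :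
    ∑ k ∈ s', ‖β k‖ ^ 2
      ≤ (∫ t in (0:ℝ)..T, ‖expSum s neumannEigenvalue α t + waveSum s' β t‖ ^ 2) + 2 * H ^ 2 := by
  have h := integral_norm_sq_waveSum s' β (T - 2)
  rw [sub_add_cancel] at h
  have hpt : ∀ t ∈ Set.Icc (T - 2) T, ‖waveSum s' β t‖ ^ 2
      ≤ 2 * ‖expSum s neumannEigenvalue α t + waveSum s' β t‖ ^ 2 + 2 * H ^ 2 := by
    intro t ht
    have h1 := norm_sub_le (expSum s neumannEigenvalue α t + waveSum s' β t)
      (expSum s neumannEigenvalue α t)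
    rw [add_sub_cancel_left] at h1
    have h2 := h1.trans (add_le_add_right (hH t ht) _)
    have h3 := pow_le_pow_left₀ (norm_nonneg _) h2 2
    nlinarith [sq_nonneg (‖expSum s neumannEigenvalue α t + waveSum s' β t‖ - H)]
  have h1 := intervalIntegral.integral_mono_on (μ := volume) (by linarith : T - 2 ≤ T)
    (Continuous.intervalIntegrable (by fun_prop) _ _)
    (Continuous.intervalIntegrable (by fun_prop) _ _) hpt
  rw [intervalIntegral.integral_add (Continuous.intervalIntegrable (by fun_prop) _ _)
    (Continuous.intervalIntegrable (by fun_prop) _ _), intervalIntegral.integral_const_mul,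
    intervalIntegral.integral_const, smul_eq_mul, h] at h1
  have h2 := intervalIntegral.integral_mono_interval (μ := volume) (a := T - 2) (b := T) (c := 0)
    (d := T) (f := fun t => ‖expSum s neumannEigenvalue α t + waveSum s' β t‖ ^ 2) (by linarith)
    (by linarith) le_rfl (Eventually.of_forall fun _ => sq_nonneg _)
    (Continuous.intervalIntegrable (by fun_prop) _ _)
  linarith


/-- Ingham-type observability inequality mixing the heat exponentials `e^{−(jπ)² t}`
and the wave exponentials `e^{i(k+1/2)π t}`: for every `T > 2` there is `C > 0` such
that for all finitely supported `(α_j)_{j≥0}`, `(β_k)_{k∈ℤ}`,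
`∑_j e^{−2T(jπ)²}|α_j|² + ∑_k |β_k|² ≤ C ∫₀ᵀ |∑_j α_j e^{−(jπ)² t} + ∑_k β_k e^{i(k+1/2)π t}|² dt`. -/
theorem stmt_15 (T : ℝ) (hT : 2 < T) :
    ∃ C > (0:ℝ), ∀ (α : ℕ → ℂ) (β : ℤ → ℂ),
      (Function.support α).Finite → (Function.support β).Finite →
      (∑' j : ℕ, Real.exp (-2 * T * ((j:ℝ) * Real.pi) ^ 2) * ‖α j‖ ^ 2)
          + (∑' k : ℤ, ‖β k‖ ^ 2)
        ≤ C * ∫ t in (0:ℝ)..T,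
            ‖(∑' j : ℕ, α j * Complex.exp (-((((j:ℝ) * Real.pi) ^ 2 * t : ℝ) : ℂ)))
              + (∑' k : ℤ, β k *
                  Complex.exp (Complex.I * ((((k:ℝ) + 1/2) * Real.pi * t : ℝ) : ℂ)))‖ ^ 2 := by
  obtain ⟨M, hM, h⟩ := exists_norm_coeff_le_integral_mixed (T := T) (ε := (T - 2) / 2)
    (by linarith) (by linarith)
  set S₁ := ∑' j, Real.exp (-(2 * (T - (T - 2) / 2)) * neumannEigenvalue j)
  set S₂ := ∑' j, Real.exp (-(T - 2 - (T - 2) / 2) * neumannEigenvalue j)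
  have hS₁ : 0 ≤ S₁ := tsum_nonneg fun _ => (Real.exp_pos _).le
  refine ⟨M ^ 2 * S₁ + (1 + 2 * (M * S₂) ^ 2), by positivity, fun α β hα hβ => ?_⟩
  set s := hα.toFinset
  set s' := hβ.toFinset
  have hα0 : ∀ j ∉ s, α j = 0 := fun j hj => by simpa [s] using hj
  have hβ0 : ∀ k ∉ s', β k = 0 := fun k hk => by simpa [s'] using hk
  have e : ∀ t : ℝ, (∑' j : ℕ, α j * Complex.exp (-((((j:ℝ) * Real.pi) ^ 2 * t : ℝ) : ℂ)))
      + (∑' k : ℤ, β k * Complex.exp (Complex.I * ((((k:ℝ) + 1/2) * Real.pi * t : ℝ) : ℂ)))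
      = expSum s neumannEigenvalue α t + waveSum s' β t := by
    intro t
    rw [tsum_eq_sum (s := s) fun j hj => by rw [hα0 j hj, zero_mul],
      tsum_eq_sum (s := s') fun k hk => by rw [hβ0 k hk, zero_mul]]
    simp only [expSum, waveSum, neumannEigenvalue, Complex.ofReal_exp, Complex.ofReal_neg]
  simp_rw [e]
  rw [tsum_eq_sum (s := s) fun j hj => by simp [hα0 j hj],
    tsum_eq_sum (s := s') fun k hk => by simp [hβ0 k hk]]
  set I := ∫ t in (0:ℝ)..T, ‖expSum s neumannEigenvalue α t + waveSum s' β t‖ ^ 2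
  have hI : 0 ≤ I := intervalIntegral.integral_nonneg (by linarith) fun _ _ => sq_nonneg _
  have hα' : ∀ j ∈ s, ‖α j‖ ≤ M * √I * Real.exp ((T - 2) / 2 * neumannEigenvalue j) :=
    fun j hj => (h s α s' β j hj).trans_eq (mul_right_comm _ _ _)
  have h1 := sum_exp_mul_norm_sq_le (T := T) (by linarith) hα'
  have h2 := sum_norm_sq_wave_le (s' := s') (β := β) hT fun t ht =>
    norm_expSum_neumannEigenvalue_le (τ := T - 2) (by positivity) (by linarith) ht.1 hα'
  refine (add_le_add h1 h2).trans_eq ?_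
  rw [mul_pow, mul_pow, mul_pow, mul_pow, Real.sq_sqrt hI]
  ring
end

section
/- Let φ : [0,1] → ℝ be twice continuously differentiable with φ'(1) = 0. For integers j ≥ 2 set λ_j := ((j−1)π)² and a_j := 2·(−1)^{j−1}·∫₀¹ φ(x)·cos((j−1)πx) dx. Then for every t > 0 the series ∑_{j≥2} ((1 − e^{−λ_j t})/(t·λ_j))·a_j converges absolutely, and lim_{t → 0⁺} [ ∫₀¹ φ(x) dx + ∑_{j=2}^∞ ((1 − e^{−λ_j t})/(t·λ_j))·a_j ] = φ(1). -/
open Real Set Filter Topology intervalIntegral in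
/-- Green's formula on `[0,1]`: two integrations by parts. -/
theorem integral_mul_second_deriv_eq {φ φ' φ'' g g' g'' : ℝ → ℝ}
    (h1 : ∀ x ∈ Icc (0:ℝ) 1, HasDerivWithinAt φ (φ' x) (Icc 0 1) x)
    (h2 : ∀ x ∈ Icc (0:ℝ) 1, HasDerivWithinAt φ' (φ'' x) (Icc 0 1) x)
    (h3 : ContinuousOn φ'' (Icc 0 1))
    (hg : ∀ x, HasDerivAt g (g' x) x) (hg' : ∀ x, HasDerivAt g' (g'' x) x)
    (hg'' : Continuous g'') :
    ∫ x in (0:ℝ)..1, φ'' x * g x =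
      (φ' 1 * g 1 - φ 1 * g' 1) - (φ' 0 * g 0 - φ 0 * g' 0) + ∫ x in (0:ℝ)..1, φ x * g'' x := by
  have hI : uIcc (0:ℝ) 1 = Icc 0 1 := uIcc_of_le zero_le_one
  have i0 : IntervalIntegrable φ' MeasureTheory.volume 0 1 :=
    ContinuousOn.intervalIntegrable (hI ▸ fun x hx => (h2 x hx).continuousWithinAt)
  have i1 : IntervalIntegrable φ'' MeasureTheory.volume 0 1 :=
    ContinuousOn.intervalIntegrable (hI ▸ h3)
  have c1 : Continuous g' := continuous_iff_continuousAt.2 fun x => (hg' x).continuousAt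
  have e1 := integral_mul_deriv_eq_deriv_mul_of_hasDerivWithinAt (a := 0) (b := 1)
    (u := φ) (u' := φ') (v := g') (v' := g'') (hI ▸ h1)
    (fun x _ => (hg' x).hasDerivWithinAt) i0 (hg''.intervalIntegrable _ _)
  have e2 := integral_mul_deriv_eq_deriv_mul_of_hasDerivWithinAt (a := 0) (b := 1)
    (u := φ') (u' := φ'') (v := g) (v' := g') (hI ▸ h2)
    (fun x _ => (hg x).hasDerivWithinAt) i1 (c1.intervalIntegrable _ _)
  linarith

open Real Set in
/-- The cosine series of `x ↦ x² / 2 - 1 / 6` on `[0,1]`. -/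
theorem hasSum_cos_series_sq {x : ℝ} (hx : x ∈ Icc (0:ℝ) 1) :
    HasSum (fun n : ℕ => 2 * (-1:ℝ) ^ (n + 1) / (((n:ℝ) + 1) * π) ^ 2 * cos (((n:ℝ) + 1) * π * x))
      (x ^ 2 / 2 - 1 / 6) := by
  have hy : (1 + x) / 2 ∈ Icc (0:ℝ) 1 := ⟨by linarith [hx.1], by linarith [hx.2]⟩
  have h := hasSum_one_div_nat_pow_mul_cos one_ne_zero hy
  rw [← hasSum_nat_add_iff' 1] at h
  have hp := pi_ne_zero
  convert! h.mul_left (2 / π ^ 2) using 1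
  · ext n
    have hc : cos (2 * π * ((n + 1 : ℕ) : ℝ) * ((1 + x) / 2))
        = (-1) ^ (n + 1) * cos (((n:ℝ) + 1) * π * x) := by
      rw [← cos_add_nat_mul_pi]
      congr 1
      push_cast
      ring
    rw [hc]
    push_cast
    field_simp
  · have hb : ((Polynomial.bernoulli 2).map (algebraMap ℚ ℝ)).eval ((1 + x) / 2)
        = ((1 + x) / 2) ^ 2 - (1 + x) / 2 + 1 / 6 := by
      simp [Polynomial.bernoulli, Finset.sum_range_succ, bernoulli_two]
      ring
    simp only [mul_one, hb]
    simp [Nat.factorial]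
    field_simp
    ring

open Real Set MeasureTheory in
/-- The cosine series of a `C²` function with `φ'(1) = 0` sums to `φ` at the endpoint `1`. -/
theorem hasSum_cos_coeff_at_one {φ φ' φ'' : ℝ → ℝ}
    (h1 : ∀ x ∈ Icc (0:ℝ) 1, HasDerivWithinAt φ (φ' x) (Icc 0 1) x)
    (h2 : ∀ x ∈ Icc (0:ℝ) 1, HasDerivWithinAt φ' (φ'' x) (Icc 0 1) x)
    (h3 : ContinuousOn φ'' (Icc 0 1)) (h4 : φ' 1 = 0) :
    HasSum (fun n : ℕ => 2 * (-1:ℝ) ^ (n + 1) *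
        ∫ x in (0:ℝ)..1, φ x * cos (((n:ℝ) + 1) * π * x))
      (φ 1 - ∫ x in (0:ℝ)..1, φ x) := by
  have hI : uIoc (0:ℝ) 1 ⊆ Icc 0 1 := by
    rw [uIoc_of_le zero_le_one]
    exact Ioc_subset_Icc_self
  set b : ℕ → ℝ → ℝ := fun n x =>
    2 * (-1:ℝ) ^ (n + 1) / (((n:ℝ) + 1) * π) ^ 2 * cos (((n:ℝ) + 1) * π * x) with hb
  have hmeas : AEStronglyMeasurable φ'' (volume.restrict (uIoc (0:ℝ) 1)) :=
    (h3.mono hI).aestronglyMeasurable measurableSet_uIoc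
  have hs : Summable fun n : ℕ => 2 / (((n:ℝ) + 1) * π) ^ 2 := by
    have := ((summable_nat_add_iff 1).2 (Real.summable_one_div_nat_pow.2 one_lt_two)).mul_left
      (2 / π ^ 2)
    refine this.congr fun n => ?_
    push_cast
    field_simp
  have hsum : HasSum (fun n => ∫ x in (0:ℝ)..1, φ'' x * b n x)
      (∫ x in (0:ℝ)..1, φ'' x * (x ^ 2 / 2 - 1 / 6)) := by
    refine intervalIntegral.hasSum_integral_of_dominated_convergence
      (fun n x => |φ'' x| * (2 / (((n:ℝ) + 1) * π) ^ 2)) (fun n => ?_) (fun n => ?_) ?_ ?_ ?_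
    · exact hmeas.mul (Continuous.aestronglyMeasurable (by fun_prop))
    · refine .of_forall fun x _ => ?_
      rw [norm_mul, Real.norm_eq_abs, Real.norm_eq_abs]
      refine mul_le_mul_of_nonneg_left ?_ (abs_nonneg _)
      simp only [hb, abs_mul, abs_div, abs_pow, abs_neg, abs_one, one_pow, abs_two, mul_one]
      rw [← abs_mul, sq_abs]
      exact mul_le_of_le_one_right (by positivity) (abs_cos_le_one _)
    · exact .of_forall fun x _ => hs.mul_left _
    · simp_rw [tsum_mul_left]
      refine ContinuousOn.intervalIntegrable ?_
      rw [uIcc_of_le zero_le_one]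
      exact h3.abs.mul continuousOn_const
    · exact .of_forall fun x hx => (hasSum_cos_series_sq (hI hx)).mul_left _
  have hP := integral_mul_second_deriv_eq (g := fun x => x ^ 2 / 2 - 1 / 6) (g' := fun x => x)
    (g'' := fun _ => 1) h1 h2 h3
    (fun x => by
      convert! ((hasDerivAt_pow 2 x).div_const 2).sub_const (1 / 6) using 1
      simp)
    hasDerivAt_id continuous_const
  have h0 := (hasSum_cos_series_sq (left_mem_Icc.2 (zero_le_one' ℝ))).mul_left (-φ' 0)
  convert! h0.sub hsum using 1
  · ext n
    set w : ℝ := ((n:ℝ) + 1) * π with hw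
    have hw0 : w ≠ 0 := by positivity
    have hsin : sin w = 0 := by
      have := sin_nat_mul_pi (n + 1)
      rwa [Nat.cast_add_one] at this
    have hG := integral_mul_second_deriv_eq (g := fun x => cos (w * x))
      (g' := fun x => -w * sin (w * x)) (g'' := fun x => -w ^ 2 * cos (w * x)) h1 h2 h3
      (fun x => by
        convert! ((hasDerivAt_id x).const_mul w).cos using 1
        simp
        ring)
      (fun x => by
        convert! (((hasDerivAt_id x).const_mul w).sin).const_mul (-w) using 1
        simp
        ring)
      (by fun_prop)
    have e1 : ∫ x in (0:ℝ)..1, φ'' x * b n x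
        = 2 * (-1:ℝ) ^ (n + 1) / w ^ 2 * ∫ x in (0:ℝ)..1, φ'' x * cos (w * x) := by
      rw [← intervalIntegral.integral_const_mul]
      congr 1 with x
      simp only [hb, ← hw]
      ring
    have e2 : ∫ x in (0:ℝ)..1, φ x * (-w ^ 2 * cos (w * x))
        = -w ^ 2 * ∫ x in (0:ℝ)..1, φ x * cos (w * x) := by
      rw [← intervalIntegral.integral_const_mul]
      congr 1 with x
      ring
    rw [e2] at hG
    rw [e1, hG]
    simp [h4, hsin]
    field_simp
    ring
  · rw [hP]
    simp [h4]
    ring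

open Real in
/-- The time averages of `exp (-l s)` over `[0,t]` lie in `[0,1]`. -/
theorem abs_one_sub_exp_div_le_one {t l : ℝ} (ht : 0 < t) (hl : 0 < l) :
    |(1 - exp (-l * t)) / (t * l)| ≤ 1 := by
  have h : exp (-l * t) ≤ 1 := exp_le_one_iff.2 (by nlinarith)
  rw [abs_of_nonneg (div_nonneg (by linarith) (by positivity)), div_le_one (by positivity)]
  linarith [add_one_le_exp (-l * t)]

open Real Filter Topology in
/-- The time averages of `exp (-l s)` over `[0,t]` tend to `1` as `t → 0`. -/
theorem tendsto_one_sub_exp_div {l : ℝ} (hl : l ≠ 0) :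
    Tendsto (fun t => (1 - exp (-l * t)) / (t * l)) (𝓝[>] 0) (𝓝 1) := by
  have h : HasDerivAt (fun t => exp (-l * t)) (-l) 0 := by
    convert! ((hasDerivAt_id (0:ℝ)).const_mul (-l)).exp using 1
    simp
  have h' := (h.tendsto_slope.mono_left
    (nhdsWithin_mono 0 fun t (ht : 0 < t) => ht.ne')).mul_const (-l⁻¹)
  rw [neg_mul_neg, mul_inv_cancel₀ hl] at h'
  refine h'.congr fun t => ?_
  simp only [slope_def_field, mul_zero, exp_zero, sub_zero]
  field_simp
  ring


/-- Identification of the control operator: for `φ` twice continuously differentiable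
on `[0,1]` with `φ'(1) = 0`, setting `λ_j = ((j−1)π)²` and
`a_j = 2(−1)^{j−1} ∫₀¹ φ(x) cos((j−1)πx) dx` (here `j = n + 2`), the series
`∑_{j≥2} ((1−e^{−λ_j t})/(tλ_j)) a_j` converges absolutely for every `t > 0`, and
`∫₀¹ φ + ∑_{j≥2} ((1−e^{−λ_j t})/(tλ_j)) a_j → φ(1)` as `t → 0⁺`. -/
theorem stmt_16 (φ φ' φ'' : ℝ → ℝ)
    (h1 : ∀ x ∈ Set.Icc (0:ℝ) 1, HasDerivWithinAt φ (φ' x) (Set.Icc 0 1) x)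
    (h2 : ∀ x ∈ Set.Icc (0:ℝ) 1, HasDerivWithinAt φ' (φ'' x) (Set.Icc 0 1) x)
    (h3 : ContinuousOn φ'' (Set.Icc 0 1))
    (h4 : φ' 1 = 0) :
    (∀ t : ℝ, 0 < t → Summable (fun n : ℕ =>
      |((1 - Real.exp (-((((n:ℝ) + 1) * Real.pi) ^ 2) * t))
          / (t * (((n:ℝ) + 1) * Real.pi) ^ 2)) *
        (2 * (-1:ℝ) ^ (n + 1) *
          ∫ x in (0:ℝ)..1, φ x * Real.cos (((n:ℝ) + 1) * Real.pi * x))|)) ∧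
    Filter.Tendsto (fun t : ℝ =>
        (∫ x in (0:ℝ)..1, φ x) + ∑' n : ℕ,
          ((1 - Real.exp (-((((n:ℝ) + 1) * Real.pi) ^ 2) * t))
              / (t * (((n:ℝ) + 1) * Real.pi) ^ 2)) *
            (2 * (-1:ℝ) ^ (n + 1) *
              ∫ x in (0:ℝ)..1, φ x * Real.cos (((n:ℝ) + 1) * Real.pi * x)))
      (nhdsWithin 0 (Set.Ioi 0)) (nhds (φ 1)) := by
  have ha := hasSum_cos_coeff_at_one h1 h2 h3 h4
  have hl (n : ℕ) : 0 < (((n:ℝ) + 1) * Real.pi) ^ 2 := by positivity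
  have hbound {t : ℝ} (ht : 0 < t) (n : ℕ) (c : ℝ) :
      |((1 - Real.exp (-((((n:ℝ) + 1) * Real.pi) ^ 2) * t))
          / (t * (((n:ℝ) + 1) * Real.pi) ^ 2)) * c| ≤ |c| := by
    rw [abs_mul]
    exact mul_le_of_le_one_left (abs_nonneg _) (abs_one_sub_exp_div_le_one ht (hl n))
  refine ⟨fun t ht => ha.summable.abs.of_nonneg_of_le (fun _ => abs_nonneg _)
    fun n => hbound ht n _, ?_⟩
  have hlim := tendsto_tsum_of_dominated_convergence ha.summable.abs
    (fun n => (tendsto_one_sub_exp_div (hl n).ne').mul_const _)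
    (eventually_nhdsWithin_of_forall fun t ht n => hbound ht n _)
  simp only [one_mul] at hlim
  rw [ha.tsum_eq] at hlim
  simpa only [add_sub_cancel] using hlim.const_add (∫ x in (0:ℝ)..1, φ x)
end

section
/- For integers j ≥ 1 set λ_j := ((j−1)π)² and define f_j, g_j : [0,1] → ℝ by f_j(x) = e^{λ_j x}/(1 + e^{2λ_j}) and g_j(x) = −e^{2λ_j}·e^{−λ_j x}/(1 + e^{2λ_j}). Then for every j ≥ 1: f_j'(x) = λ_j·f_j(x) and g_j'(x) = −λ_j·g_j(x) on [0,1], g_j(1) = −f_j(1), and f_j(0) − g_j(0) = 1. Moreover ∑_{j=1}^∞ ∫₀¹ ( f_j(x)² + g_j(x)² ) dx < ∞; more precisely ∫₀¹ f_j(x)² dx = (e^{2λ_j}−1)/(2λ_j(1+e^{2λ_j})²) ∼ e^{−2λ_j}/(2λ_j) and ∫₀¹ g_j(x)² dx ∼ 1/(2λ_j) as j → ∞. -/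
/-- `λ_j = ((j−1)π)²`. -/
noncomputable def lamj (j : ℕ) : ℝ := (((j:ℝ) - 1) * Real.pi) ^ 2

/-- `f_j(x) = e^{λ_j x}/(1 + e^{2λ_j})`. -/
noncomputable def fj (j : ℕ) (x : ℝ) : ℝ :=
  Real.exp (lamj j * x) / (1 + Real.exp (2 * lamj j))

/-- `g_j(x) = −e^{2λ_j} e^{−λ_j x}/(1 + e^{2λ_j})`. -/
noncomputable def gj (j : ℕ) (x : ℝ) : ℝ :=
  -(Real.exp (2 * lamj j) * Real.exp (-(lamj j) * x)) / (1 + Real.exp (2 * lamj j))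

theorem lamj_pos {j : ℕ} (hj : 2 ≤ j) : 0 < lamj j := by
  have h : (2 : ℝ) ≤ j := by exact_mod_cast hj
  have h1 : (0 : ℝ) < (j : ℝ) - 1 := by linarith
  unfold lamj
  positivity

theorem tendsto_lamj : Filter.Tendsto lamj Filter.atTop Filter.atTop := by
  have h : Filter.Tendsto (fun j : ℕ => (j : ℝ) - 1) Filter.atTop Filter.atTop :=
    Filter.tendsto_atTop_add_const_right _ _ tendsto_natCast_atTop_atTop
  exact (Filter.tendsto_pow_atTop two_ne_zero).comp (h.atTop_mul_const Real.pi_pos)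

theorem integral_exp_mul_zero_one {a : ℝ} (ha : a ≠ 0) :
    ∫ x in (0 : ℝ)..1, Real.exp (a * x) = (Real.exp a - 1) / a := by
  rw [intervalIntegral.integral_comp_mul_left _ ha, integral_exp]
  simp [div_eq_inv_mul]

theorem integral_fj_sq {j : ℕ} (hj : 2 ≤ j) :
    ∫ x in (0 : ℝ)..1, (fj j x) ^ 2
      = (Real.exp (2 * lamj j) - 1) / (2 * lamj j * (1 + Real.exp (2 * lamj j)) ^ 2) := by
  have h (x : ℝ) : (fj j x) ^ 2
      = Real.exp (2 * lamj j * x) / (1 + Real.exp (2 * lamj j)) ^ 2 := by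
    rw [fj, div_pow, ← Real.exp_nat_mul]
    push_cast
    ring_nf
  have hl := lamj_pos hj
  simp_rw [h]
  rw [intervalIntegral.integral_div, integral_exp_mul_zero_one (by positivity), div_div]

theorem integral_gj_sq {j : ℕ} (hj : 2 ≤ j) :
    ∫ x in (0 : ℝ)..1, (gj j x) ^ 2
      = Real.exp (2 * lamj j) * (Real.exp (2 * lamj j) - 1)
        / (2 * lamj j * (1 + Real.exp (2 * lamj j)) ^ 2) := by
  have h (x : ℝ) : (gj j x) ^ 2
      = Real.exp (2 * lamj j) ^ 2 / (1 + Real.exp (2 * lamj j)) ^ 2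
        * Real.exp (-(2 * lamj j) * x) := by
    rw [gj, div_pow, neg_sq, mul_pow, ← Real.exp_nat_mul (-(lamj j) * x)]
    push_cast
    ring_nf
  have hl := lamj_pos hj
  simp_rw [h]
  rw [intervalIntegral.integral_const_mul, integral_exp_mul_zero_one (by linarith), Real.exp_neg]
  have hE := Real.exp_pos (2 * lamj j)
  field_simp
  ring

theorem continuous_fj (j : ℕ) : Continuous (fj j) := by
  unfold fj
  fun_prop

theorem continuous_gj (j : ℕ) : Continuous (gj j) := by
  unfold gj
  fun_prop

theorem integral_fj_sq_add_gj_sq_le {j : ℕ} (hj : 2 ≤ j) :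
    ∫ x in (0 : ℝ)..1, ((fj j x) ^ 2 + (gj j x) ^ 2) ≤ 1 / (2 * lamj j) := by
  have hf : IntervalIntegrable (fun x => (fj j x) ^ 2) MeasureTheory.volume 0 1 :=
    ((continuous_fj j).pow 2).intervalIntegrable _ _
  have hg : IntervalIntegrable (fun x => (gj j x) ^ 2) MeasureTheory.volume 0 1 :=
    ((continuous_gj j).pow 2).intervalIntegrable _ _
  rw [intervalIntegral.integral_add hf hg, integral_fj_sq hj, integral_gj_sq hj, ← add_div]
  have hl := lamj_pos hj
  have hE := Real.exp_pos (2 * lamj j)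
  rw [div_le_div_iff₀ (by positivity) (by positivity)]
  have h : 0 ≤ 2 * lamj j * (1 + Real.exp (2 * lamj j)) := by positivity
  nlinarith

theorem summable_integral_fj_sq_add_gj_sq :
    Summable fun j : ℕ => ∫ x in (0 : ℝ)..1, ((fj (j + 1) x) ^ 2 + (gj (j + 1) x) ^ 2) := by
  rw [← summable_nat_add_iff 1]
  have hs : Summable fun j : ℕ => 1 / (2 * Real.pi ^ 2) * (1 / ((j + 1 : ℕ) : ℝ) ^ 2) :=
    ((summable_nat_add_iff 1).mpr (Real.summable_one_div_nat_pow.mpr one_lt_two)).mul_left _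
  refine hs.of_nonneg_of_le (fun j => ?_) fun j => ?_
  · exact intervalIntegral.integral_nonneg zero_le_one fun x _ => by positivity
  · refine (integral_fj_sq_add_gj_sq_le (by lia)).trans_eq ?_
    have hpi := Real.pi_ne_zero
    simp only [lamj]
    push_cast
    rw [add_sub_cancel_right]
    field_simp

theorem tendsto_exp_two_lamj_ratio :
    Filter.Tendsto (fun j : ℕ => Real.exp (2 * lamj j) * (Real.exp (2 * lamj j) - 1)
      / (1 + Real.exp (2 * lamj j)) ^ 2) Filter.atTop (nhds 1) := by
  have h : Filter.Tendsto (fun j : ℕ => Real.exp (-(2 * lamj j))) Filter.atTop (nhds 0) :=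
    Real.tendsto_exp_neg_atTop_nhds_zero.comp (tendsto_lamj.const_mul_atTop two_pos)
  have h1 : Filter.Tendsto (fun j : ℕ => (1 - Real.exp (-(2 * lamj j)))
      / (1 + Real.exp (-(2 * lamj j))) ^ 2) Filter.atTop (nhds ((1 - 0) / (1 + 0) ^ 2)) :=
    (h.const_sub 1).div ((h.const_add 1).pow 2) (by norm_num)
  norm_num at h1
  refine h1.congr fun j => ?_
  have hE := Real.exp_pos (2 * lamj j)
  rw [Real.exp_neg]
  field_simp
  ring

/-- The Riemann-coordinate components of the parabolic eigenvectors: `f_j' = λ_j f_j`,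
`g_j' = −λ_j g_j`, `g_j(1) = −f_j(1)`, `f_j(0) − g_j(0) = 1`, quadratic summability
`∑ ∫₀¹ (f_j² + g_j²) < ∞`, the exact value of `∫₀¹ f_j²` and the asymptotics
`∫₀¹ f_j² ∼ e^{−2λ_j}/(2λ_j)`, `∫₀¹ g_j² ∼ 1/(2λ_j)`. -/
theorem stmt_18 :
    (∀ j : ℕ, 1 ≤ j →
      (∀ x ∈ Set.Icc (0:ℝ) 1, HasDerivAt (fj j) (lamj j * fj j x) x) ∧
      (∀ x ∈ Set.Icc (0:ℝ) 1, HasDerivAt (gj j) (-(lamj j) * gj j x) x) ∧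
      gj j 1 = -(fj j 1) ∧ fj j 0 - gj j 0 = 1) ∧
    (Summable fun j : ℕ =>
      ∫ x in (0:ℝ)..1, ((fj (j+1) x) ^ 2 + (gj (j+1) x) ^ 2)) ∧
    (∀ j : ℕ, 2 ≤ j →
      (∫ x in (0:ℝ)..1, (fj j x) ^ 2)
        = (Real.exp (2 * lamj j) - 1)
            / (2 * lamj j * (1 + Real.exp (2 * lamj j)) ^ 2)) ∧
    Filter.Tendsto
      (fun j : ℕ => (∫ x in (0:ℝ)..1, (fj j x) ^ 2)
        / (Real.exp (-2 * lamj j) / (2 * lamj j)))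
      Filter.atTop (nhds 1) ∧
    Filter.Tendsto
      (fun j : ℕ => (∫ x in (0:ℝ)..1, (gj j x) ^ 2) / (1 / (2 * lamj j)))
      Filter.atTop (nhds 1) := by
  refine ⟨fun j _ => ⟨fun x _ => ?_, fun x _ => ?_, ?_, ?_⟩, summable_integral_fj_sq_add_gj_sq,
    fun j hj => integral_fj_sq hj, ?_, ?_⟩
  · have h := ((((hasDerivAt_id x).const_mul (lamj j)).exp).div_const
      (1 + Real.exp (2 * lamj j)))
    refine h.congr_deriv ?_
    simp only [fj, id]
    ring
  · have h := (((((hasDerivAt_id x).const_mul (-(lamj j))).exp).const_mul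
      (Real.exp (2 * lamj j))).neg.div_const (1 + Real.exp (2 * lamj j)))
    refine h.congr_deriv ?_
    simp only [gj, id]
    ring
  · rw [gj, fj, ← Real.exp_add, neg_div]
    ring_nf
  · have hE := Real.exp_pos (2 * lamj j)
    simp only [gj, fj, mul_zero, Real.exp_zero]
    field_simp
    ring
  · refine tendsto_exp_two_lamj_ratio.congr' ?_
    filter_upwards [Filter.eventually_ge_atTop 2] with j hj
    have hl := lamj_pos hj
    have hE := Real.exp_pos (2 * lamj j)
    rw [integral_fj_sq hj, neg_mul, Real.exp_neg]
    field_simp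
  · refine tendsto_exp_two_lamj_ratio.congr' ?_
    filter_upwards [Filter.eventually_ge_atTop 2] with j hj
    have hl := lamj_pos hj
    have hE := Real.exp_pos (2 * lamj j)
    rw [integral_gj_sq hj]
    field_simp
end
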